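/- (Kahane–Saïas.) Let a Beurling generalized number system be given. If ∫_2^∞ |Π(x) − x/log x| x^{−2} dx < ∞, then m(x) → 0 as x → ∞. -/

import Mathlib

open Filter MeasureTheory Set Topology
open scoped Classical

/-- Value `n(α) = ∏ p_k^{α(k)}` of a generalized integer `α`. -/
noncomputable def nval (p : ℕ → ℝ) (α : ℕ →₀ ℕ) : ℝ := α.prod fun k e => p k ^ e

/-- Counting function `N(x)` of the generalized integers. -/
noncomputable def Ncount (p : ℕ → ℝ) (x : ℝ) : ℕ := Nat.card {α : ℕ →₀ ℕ // nval p α ≤ x}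

/-- Riemann prime counting function `Π(x) = Σ_{j ≥ 1} π(x^{1/j})/j`. -/
noncomputable def PiCount (p : ℕ → ℝ) (x : ℝ) : ℝ :=
  ∑' j : ℕ, (Nat.card {k : ℕ // p k ≤ x ^ ((1 : ℝ) / (j + 1))} : ℝ) / (j + 1)

/-- `log ζ(s) = ∫_1^∞ x^{-s} dΠ(x)`, the Lebesgue–Stieltjes integral against the purely
atomic measure `dΠ`, which carries mass `1/j` at each point `p_k^j`. -/
noncomputable def logZeta (p : ℕ → ℝ) (s : ℂ) : ℂ :=
  ∑' (j : ℕ) (k : ℕ), ((p k : ℂ) ^ (-s * (j + 1))) / (j + 1)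

/-- The Beurling zeta function `ζ(s) = exp(∫_1^∞ x^{-s} dΠ(x))`. -/
noncomputable def zetaB (p : ℕ → ℝ) (s : ℂ) : ℂ := Complex.exp (logZeta p s)

/-- Beurling Möbius function. -/
noncomputable def muB (α : ℕ →₀ ℕ) : ℝ :=
  if ∀ k, α k ≤ 1 then (-1 : ℝ) ^ α.support.card else 0

/-- `m(x) = Σ_{n(α) ≤ x} μ(α)/n(α)`. -/
noncomputable def mB (p : ℕ → ℝ) (x : ℝ) : ℝ :=
  ∑' α : {α : ℕ →₀ ℕ // nval p α ≤ x}, muB α / nval p α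

/-- Beurling Liouville function. -/
noncomputable def lambdaB (α : ℕ →₀ ℕ) : ℝ := (-1 : ℝ) ^ (α.sum fun _ e => e)

/-- `ℓ(x) = Σ_{n(α) ≤ x} λ(α)/n(α)`. -/
noncomputable def ellB (p : ℕ → ℝ) (x : ℝ) : ℝ :=
  ∑' α : {α : ℕ →₀ ℕ // nval p α ≤ x}, lambdaB α / nval p α

/-- An analytic function `G` on `{Re s > 1}` has `A_loc`-boundary behavior on `1 + iU`:
for every compact `K ⊂ U` there is `g ∈ L¹(ℝ)` with `G(σ + it) → ∫ g(x) e^{-itx} dx`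
as `σ → 1⁺`, uniformly for `t ∈ K`. -/
def ALocBoundary (G : ℂ → ℂ) (U : Set ℝ) : Prop :=
  ∀ K : Set ℝ, K ⊆ U → IsCompact K → ∃ g : ℝ → ℂ, Integrable g ∧
    TendstoUniformlyOn (fun σ : ℝ => fun t : ℝ => G (σ + t * Complex.I))
      (fun t : ℝ => ∫ x : ℝ, g x * Complex.exp (-(t * x) * Complex.I)) (𝓝[>] 1) K

/-- An analytic function `G` on `{Re s > 1}` has local pseudofunction boundary behavior on
`1 + iU`: for every smooth compactly supported `φ` with `supp φ ⊂ U` and every `x`, the limit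
`g_φ(x) = lim_{σ→1⁺} ∫ G(σ + it) φ(t) e^{-ixt} dt` exists, and `g_φ(x) → 0` as `|x| → ∞`. -/
def LocalPseudofunctionBoundary (G : ℂ → ℂ) (U : Set ℝ) : Prop :=
  ∀ φ : ℝ → ℂ, ContDiff ℝ (⊤ : ℕ∞) φ → HasCompactSupport φ → tsupport φ ⊆ U →
    ∃ gφ : ℝ → ℂ,
      (∀ x : ℝ, Tendsto (fun σ : ℝ => ∫ t : ℝ, G (σ + t * Complex.I) * φ t *
          Complex.exp (-(x * t) * Complex.I)) (𝓝[>] 1) (𝓝 (gφ x))) ∧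
      Tendsto gφ (cocompact ℝ) (𝓝 0)

/-- `Π₀(x) = ∫_1^x (1 - 1/u)/log u du`. -/
noncomputable def Pi0 (x : ℝ) : ℝ := ∫ u in (1:ℝ)..x, (1 - 1/u) / Real.log u

/-- `ec x = exp(2πix)`. -/
noncomputable def ec (x : ℝ) : ℂ := Complex.exp ((2 * Real.pi * x : ℝ) * Complex.I)

lemma norm_ec (x : ℝ) : ‖ec x‖ = 1 := by
  unfold ec; exact Complex.norm_exp_ofReal_mul_I _

lemma ec_add (x y : ℝ) : ec (x + y) = ec x * ec y := by
  unfold ec; rw [← Complex.exp_add]; congr 1; push_cast; ring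

lemma ec_zero : ec 0 = 1 := by simp [ec]

@[fun_prop] lemma continuous_ec : Continuous ec := by unfold ec; fun_prop

noncomputable def IF (c : ℝ → ℂ) (y : ℝ) : ℂ := ∫ t, c t * ec (t * y)
noncomputable def FT (a : ℝ → ℂ) (t : ℝ) : ℂ := ∫ u, a u * ec (-(t * u))

lemma IF_eq (c : ℝ → ℂ) : IF c = FourierTransformInv.fourierInv c := by
  ext y
  rw [Real.fourierInv_eq']
  unfold IF ec
  congr 1; ext t
  simp only [smul_eq_mul, RCLike.inner_apply, conj_trivial]
  rw [mul_comm]; congr 2; push_cast; ring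

lemma FT_eq (c : ℝ → ℂ) : FT c = FourierTransform.fourier c := by
  ext y
  rw [Real.fourier_eq']
  unfold FT ec
  congr 1; ext t
  simp only [smul_eq_mul, RCLike.inner_apply, conj_trivial]
  rw [mul_comm]; congr 2; push_cast; ring

lemma integrable_mul_ec {c : ℝ → ℂ} (hc : Integrable c) {φ : ℝ → ℝ} (hφ : Continuous φ) :
    Integrable (fun t => c t * ec (φ t)) := by
  refine hc.mul_bdd (c := 1) (by fun_prop) ?_
  exact Eventually.of_forall fun t => by rw [norm_ec]

lemma norm_FT_le {a : ℝ → ℂ} (t : ℝ) : ‖FT a t‖ ≤ ∫ u, ‖a u‖ := by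
  unfold FT
  refine (norm_integral_le_integral_norm _).trans (le_of_eq ?_)
  simp [norm_ec]

lemma continuous_FT {a : ℝ → ℂ} (ha : Integrable a) : Continuous (FT a) := by
  unfold FT
  refine continuous_of_dominated (bound := fun u => ‖a u‖) ?_ ?_ ha.norm ?_
  · intro t; exact (integrable_mul_ec ha (by fun_prop)).aestronglyMeasurable
  · intro t; exact Eventually.of_forall fun u => by simp [norm_ec]
  · exact Eventually.of_forall fun u => by fun_prop

lemma continuous_IF {a : ℝ → ℂ} (ha : Integrable a) : Continuous (IF a) := by
  unfold IF
  refine continuous_of_dominated (bound := fun u => ‖a u‖) ?_ ?_ ha.norm ?_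
  · intro t; exact (integrable_mul_ec ha (by fun_prop)).aestronglyMeasurable
  · intro t; exact Eventually.of_forall fun u => by simp [norm_ec]
  · exact Eventually.of_forall fun u => by fun_prop

lemma IF_mul_FT {c a : ℝ → ℂ} (hc : Integrable c) (ha : Integrable a) (y : ℝ) :
    IF (fun t => c t * FT a t) y = ∫ u, a u * IF c (y - u) := by
  unfold IF FT
  have h1 : ∀ t, c t * (∫ u, a u * ec (-(t * u))) * ec (t * y)
      = ∫ u, c t * a u * ec (t * (y - u)) := by
    intro t
    rw [mul_right_comm, ← integral_const_mul]
    congr 1; ext u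
    have : ec (t * (y - u)) = ec (t * y) * ec (-(t * u)) := by
      rw [← ec_add]; congr 1; ring
    rw [this]; ring
  simp_rw [h1]
  rw [integral_integral_swap]
  · congr 1; ext u
    rw [← integral_const_mul]
    congr 1; ext t; ring
  · have : Integrable (fun z : ℝ × ℝ => c z.1 * a z.2) := hc.mul_prod ha
    refine this.mul_bdd (c := 1) ?_ ?_
    · apply Continuous.aestronglyMeasurable; fun_prop
    · exact Eventually.of_forall fun t => by rw [norm_ec]

/-- positive convolution -/
noncomputable def cv (a D : ℝ → ENNReal) (y : ℝ) : ENNReal := ∫⁻ u, a u * D (y - u)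

lemma cv_mono {a a' D D' : ℝ → ENNReal} (h : ∀ u, a u ≤ a' u) (h' : ∀ u, D u ≤ D' u) (y : ℝ) :
    cv a D y ≤ cv a' D' y := lintegral_mono fun u => mul_le_mul' (h u) (h' _)

lemma measurable_cv {a D : ℝ → ENNReal} (ha : Measurable a) (hD : Measurable D) :
    Measurable (cv a D) := by
  unfold cv
  refine Measurable.lintegral_prod_right' (f := fun z : ℝ × ℝ => a z.2 * D (z.1 - z.2)) ?_
  fun_prop

lemma lintegral_cv {a D : ℝ → ENNReal} (ha : Measurable a) (hD : Measurable D) :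
    ∫⁻ y, cv a D y = (∫⁻ u, a u) * ∫⁻ y, D y := by
  unfold cv
  rw [lintegral_lintegral_swap]
  · have : ∀ u, ∫⁻ y, a u * D (y - u) = a u * ∫⁻ y, D y := by
      intro u
      rw [lintegral_const_mul _ (by fun_prop)]
      congr 1
      exact lintegral_sub_right_eq_self (fun y => D y) u
    simp_rw [this]
    rw [lintegral_mul_const _ ha]
  · apply Measurable.aemeasurable
    unfold Function.uncurry
    fun_prop

/-- `A` is dominated by `a` on functions vanishing off `S`. -/
def Dom (S : Set ℝ) (A : ℝ → ℂ) (a : ℝ → ENNReal) : Prop :=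
  ∀ c : ℝ → ℂ, Continuous c → HasCompactSupport c → (∀ t, t ∉ S → c t = 0) → ∀ y,
    ‖IF (fun t => c t * A t) y‖ₑ ≤ cv a (fun x => ‖IF c x‖ₑ) y

lemma dom_FT {S : Set ℝ} {a : ℝ → ℂ} (ha : Integrable a) {d : ℝ → ENNReal} (hd : ∀ u, ‖a u‖ₑ ≤ d u) :
    Dom S (FT a) d := by
  intro c hc hcs _ y
  rw [IF_mul_FT (hc.integrable_of_hasCompactSupport hcs) ha]
  refine (enorm_integral_le_lintegral_enorm _).trans ?_
  unfold cv
  refine lintegral_mono fun u => ?_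
  simp only [enorm_mul]
  gcongr; exact hd u

lemma Dom.add {S : Set ℝ} {A B : ℝ → ℂ} {a b : ℝ → ENNReal} (hA : Dom S A a) (hB : Dom S B b)
    (cA : Continuous A) (cB : Continuous B) (ha : Measurable a)  :
    Dom S (fun t => A t + B t) (fun u => a u + b u) := by
  intro c hc hcs h0 y
  have hi : ∀ A : ℝ → ℂ, Continuous A → Integrable (fun t => c t * A t * ec (t * y)) := by
    intro A hA
    exact Continuous.integrable_of_hasCompactSupport (by fun_prop) (hcs.mul_right.mul_right)
  have : IF (fun t => c t * (A t + B t)) y = IF (fun t => c t * A t) y + IF (fun t => c t * B t) y := by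
    unfold IF
    rw [← integral_add (hi A cA) (hi B cB)]
    congr 1; ext t; ring
  rw [this]
  refine (enorm_add_le _ _).trans ((add_le_add (hA c hc hcs h0 y) (hB c hc hcs h0 y)).trans ?_)
  unfold cv
  rw [← lintegral_add_left' ]
  · refine lintegral_mono fun u => ?_
    simp only [add_mul]; rfl
  · have := continuous_IF (hc.integrable_of_hasCompactSupport hcs)
    fun_prop

lemma Dom.mul {S : Set ℝ} {A B : ℝ → ℂ} {a b : ℝ → ENNReal} (hA : Dom S A a) (hB : Dom S B b)
    (cB : Continuous B)
    (ha : Measurable a) (hb : Measurable b) :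
    Dom S (fun t => B t * A t) (cv a b) := by
  intro c hc hcs h0 y
  have h1 := hA (fun t => c t * B t) (by fun_prop) hcs.mul_right
    (fun t ht => by simp [h0 t ht]) y
  have h2 := hB c hc hcs h0
  simp only [mul_assoc] at h1
  have hIF := (continuous_IF (hc.integrable_of_hasCompactSupport hcs)).measurable
  refine h1.trans ((cv_mono (fun u => le_rfl) h2 y).trans (le_of_eq ?_))
  unfold cv
  have e1 : ∀ u, a u * ∫⁻ v, b v * ‖IF c (y - u - v)‖ₑ =
      ∫⁻ w, a u * b (w - u) * ‖IF c (y - w)‖ₑ := by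
    intro u
    rw [← lintegral_const_mul _ (by fun_prop)]
    rw [← lintegral_sub_right_eq_self _ u]
    congr 1; ext w
    rw [mul_assoc]; congr 4; ring
  simp_rw [e1]
  rw [lintegral_lintegral_swap]
  · congr 1; ext w
    rw [lintegral_mul_const _ (by fun_prop)]
  · apply Measurable.aemeasurable
    unfold Function.uncurry
    fun_prop

/-- dominator for exponentials -/
noncomputable def expD (a D : ℝ → ENNReal) (y : ℝ) : ENNReal :=
  ∑' n : ℕ, ENNReal.ofReal (1 / (n.factorial : ℝ)) * ((cv a)^[n] D) y

lemma measurable_iter {a D : ℝ → ENNReal} (ha : Measurable a) (hD : Measurable D) (n : ℕ) :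
    Measurable ((cv a)^[n] D) := by
  induction n with
  | zero => simpa
  | succ n ih => rw [Function.iterate_succ_apply']; exact measurable_cv ha ih

lemma measurable_expD {a D : ℝ → ENNReal} (ha : Measurable a) (hD : Measurable D) :
    Measurable (expD a D) := by
  unfold expD
  have := fun n => measurable_iter ha hD n
  fun_prop

lemma lintegral_expD {a D : ℝ → ENNReal} (ha : Measurable a) (hD : Measurable D)
    (ha' : ∫⁻ u, a u ≠ ⊤) (hD' : ∫⁻ u, D u ≠ ⊤) : ∫⁻ u, expD a D u ≠ ⊤ := by
  unfold expD
  have hm := fun n => measurable_iter ha hD n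
  rw [lintegral_tsum (fun n => by have := hm n; fun_prop)]
  have h1 : ∀ n, ∫⁻ y, ((cv a)^[n] D) y = (∫⁻ u, a u) ^ n * ∫⁻ u, D u := by
    intro n
    induction n with
    | zero => simp
    | succ n ih =>
      rw [Function.iterate_succ_apply', lintegral_cv ha (hm n), ih, pow_succ]; ring
  have h2 : ∀ n, ∫⁻ y, ENNReal.ofReal (1 / (n.factorial : ℝ)) * ((cv a)^[n] D) y =
      ENNReal.ofReal ((∫⁻ u, a u).toReal ^ n / n.factorial * (∫⁻ u, D u).toReal) := by
    intro n
    rw [lintegral_const_mul _ (hm n), h1]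
    conv_lhs => rw [← ENNReal.ofReal_toReal ha', ← ENNReal.ofReal_toReal hD']
    rw [← ENNReal.ofReal_pow (by positivity), ← ENNReal.ofReal_mul (by positivity),
      ← ENNReal.ofReal_mul (by positivity)]
    congr 1; ring
  simp_rw [h2]
  apply Summable.tsum_ofReal_ne_top
  exact (Real.summable_pow_div_factorial _).mul_right _

lemma Dom.exp {S : Set ℝ} {A : ℝ → ℂ} {a : ℝ → ENNReal} (hA : Dom S A a) (cA : Continuous A)
    {c : ℝ → ℂ} (hc : Continuous c) (hcs : HasCompactSupport c) (h0 : ∀ t, t ∉ S → c t = 0)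
    {D : ℝ → ENNReal} (hD : ∀ y, ‖IF c y‖ₑ ≤ D y) (y : ℝ) :
    ‖IF (fun t => c t * Complex.exp (A t)) y‖ₑ ≤ expD a D y := by
  have hn : ∀ n : ℕ, ∀ y, ‖IF (fun t => c t * A t ^ n) y‖ₑ ≤ ((cv a)^[n] D) y := by
    intro n
    induction n with
    | zero => simpa using hD
    | succ n ih =>
      intro y
      rw [Function.iterate_succ_apply']
      have := hA (fun t => c t * A t ^ n) (by fun_prop) hcs.mul_right
        (fun t ht => by simp [h0 t ht]) y
      simp only [mul_assoc, ← pow_succ] at this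
      exact this.trans (cv_mono (fun _ => le_rfl) ih y)
  -- sum
  have hsum : HasSum (fun n : ℕ => IF (fun t => c t * A t ^ n) y / n.factorial)
      (IF (fun t => c t * Complex.exp (A t)) y) := by
    unfold IF
    simp_rw [← integral_div]
    refine hasSum_integral_of_dominated_convergence
      (bound := fun n t => ‖c t‖ * (‖A t‖ ^ n / n.factorial)) ?_ ?_ ?_ ?_ ?_
    · intro n; apply Continuous.aestronglyMeasurable; fun_prop
    · intro n; refine Eventually.of_forall fun t => ?_
      simp [norm_ec, div_eq_mul_inv, mul_assoc]
    · refine Eventually.of_forall fun t => ?_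
      exact (Real.summable_pow_div_factorial _).mul_left _
    · have : (fun t => ∑' n : ℕ, ‖c t‖ * (‖A t‖ ^ n / n.factorial)) =
          fun t => ‖c t‖ * Real.exp ‖A t‖ := by
        ext t
        rw [tsum_mul_left, Real.exp_eq_exp_ℝ, NormedSpace.exp_eq_tsum_div]
      rw [this]
      exact Continuous.integrable_of_hasCompactSupport (by fun_prop) hcs.norm.mul_right
    · refine Eventually.of_forall fun t => ?_
      have : HasSum (fun n : ℕ => A t ^ n / n.factorial) (Complex.exp (A t)) := by
        rw [Complex.exp_eq_exp_ℂ]; exact NormedSpace.expSeries_div_hasSum_exp (A t)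
      refine ((this.mul_left (c t)).mul_right (ec (t * y))).congr_fun fun n => ?_
      ring
  rw [← hsum.tsum_eq]
  unfold expD
  refine enorm_tsum_le_tsum_enorm.trans ?_
  refine ENNReal.tsum_le_tsum fun n => ?_
  rw [div_eq_inv_mul, enorm_mul]
  gcongr
  · rw [← ofReal_norm]
    apply ENNReal.ofReal_le_ofReal
    simp
  · exact hn n y

noncomputable def sv (σ t : ℝ) : ℂ := (σ : ℂ) + ((2 * Real.pi * t : ℝ) : ℂ) * Complex.I

lemma sv_re (σ t : ℝ) : (sv σ t).re = σ := by simp [sv]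

lemma sv_ne_zero {σ t : ℝ} (h : 0 < σ) : sv σ t ≠ 0 := by
  intro h0; have := sv_re σ t; rw [h0] at this; simp at this; linarith

@[fun_prop] lemma continuous_sv (σ : ℝ) : Continuous (sv σ) := by unfold sv; fun_prop

lemma norm_sv_le {σ t : ℝ} (h0 : 0 ≤ σ) (h1 : σ ≤ 1) : ‖1 + sv σ t‖ ≤ 2 + 2 * Real.pi * |t| := by
  unfold sv
  refine (norm_add_le _ _).trans ?_
  have := norm_add_le (σ : ℂ) (((2 * Real.pi * t : ℝ) : ℂ) * Complex.I)
  rw [norm_mul, Complex.norm_I, mul_one, Complex.norm_real, Complex.norm_real, Real.norm_eq_abs,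
    Real.norm_eq_abs, abs_of_nonneg h0, abs_mul, abs_of_pos Real.two_pi_pos] at this
  rw [norm_one]; linarith

lemma exp_sv (σ t v : ℝ) : Complex.exp (-(sv σ t * v)) = (Real.exp (-(σ * v)) : ℂ) * ec (-(t * v)) := by
  unfold sv ec
  rw [Complex.ofReal_exp, ← Complex.exp_add]
  congr 1; push_cast; ring

noncomputable def lap (e : ℝ → ℂ) (s : ℂ) : ℂ := ∫ u, e u * Complex.exp (-(s * u))

lemma lap_eq (e : ℝ → ℂ) (σ t : ℝ) :
    lap e (sv σ t) = FT (fun u => e u * (Real.exp (-(σ * u)) : ℂ)) t := by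
  unfold lap FT
  congr 1; ext u
  rw [exp_sv]; ring

lemma norm_damp_le {e : ℝ → ℂ} (h0 : ∀ u < 0, e u = 0) {σ : ℝ} (hσ : 0 ≤ σ) (u : ℝ) :
    ‖e u * (Real.exp (-(σ * u)) : ℂ)‖ ≤ ‖e u‖ := by
  rcases lt_or_ge u 0 with h | h
  · simp [h0 u h]
  · rw [norm_mul, Complex.norm_real, Real.norm_eq_abs, abs_of_pos (Real.exp_pos _)]
    refine mul_le_of_le_one_right (norm_nonneg _) ?_
    rw [Real.exp_le_one_iff]
    have := mul_nonneg hσ h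
    linarith

lemma integrable_damp {e : ℝ → ℂ} (he : Integrable e) (h0 : ∀ u < 0, e u = 0) {σ : ℝ} (hσ : 0 ≤ σ) :
    Integrable (fun u => e u * (Real.exp (-(σ * u)) : ℂ)) := by
  refine he.mono ?_ (Eventually.of_forall fun u => norm_damp_le h0 hσ u)
  refine he.aestronglyMeasurable.mul ?_
  apply Continuous.aestronglyMeasurable; fun_prop

lemma norm_lap_le {e : ℝ → ℂ} (he : Integrable e) (h0 : ∀ u < 0, e u = 0) {σ : ℝ} (hσ : 0 ≤ σ)
    (t : ℝ) : ‖lap e (sv σ t)‖ ≤ ∫ u, ‖e u‖ := by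
  rw [lap_eq]
  refine (norm_FT_le t).trans ?_
  exact integral_mono (integrable_damp he h0 hσ).norm he.norm (norm_damp_le h0 hσ)

lemma tendsto_lap {e : ℝ → ℂ} (he : Integrable e) (h0 : ∀ u < 0, e u = 0) (t : ℝ) :
    Tendsto (fun σ => lap e (sv σ t)) (𝓝[>] 0) (𝓝 (lap e (sv 0 t))) := by
  simp only [lap_eq, FT]
  refine tendsto_integral_filter_of_dominated_convergence (fun u => ‖e u‖) ?_ ?_ he.norm ?_
  · filter_upwards [self_mem_nhdsWithin] with σ hσ
    exact (integrable_mul_ec (integrable_damp he h0 (le_of_lt hσ)) (by fun_prop)).aestronglyMeasurable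
  · filter_upwards [self_mem_nhdsWithin] with σ hσ
    refine Eventually.of_forall fun u => ?_
    rw [norm_mul, norm_ec, mul_one]
    exact norm_damp_le h0 (le_of_lt hσ) u
  · refine Eventually.of_forall fun u => ?_
    refine Tendsto.mono_left ?_ nhdsWithin_le_nhds
    refine Continuous.tendsto (f := fun σ : ℝ => e u * (Real.exp (-(σ * u)) : ℂ) * ec (-(t * u))) ?_ 0
    fun_prop

noncomputable def Fd (e g : ℝ → ℂ) (s : ℂ) : ℂ :=
  Complex.exp 1 * ((1 + s) * Complex.exp ((1 + s) * lap e s + lap g s))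

structure Dat where
  ι : Type
  cnt : Countable ι
  ℓ : ι → ℝ
  ℓ0 : ∀ i, 0 ≤ ℓ i
  μ : ι → ℝ
  μ1 : ∀ i, |μ i| ≤ 1
  e : ℝ → ℂ
  g : ℝ → ℂ
  me : Measurable e
  mg : Measurable g
  ie : Integrable e
  ig : Integrable g
  e0 : ∀ u < 0, e u = 0
  g0 : ∀ u < 0, g u = 0
  hZ : ∀ σ t : ℝ, 0 < σ → HasSum (fun i => Complex.exp (-((1 + sv σ t) * ℓ i)))
    (Fd e g (sv σ t) / sv σ t)
  hM : ∀ σ t : ℝ, 0 < σ → HasSum (fun i => (μ i : ℂ) * Complex.exp (-((1 + sv σ t) * ℓ i)))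
    (sv σ t / Fd e g (sv σ t))

namespace Dat
variable (d : Dat)

noncomputable def F (σ t : ℝ) : ℂ := Fd d.e d.g (sv σ t)

lemma continuous_lap {e : ℝ → ℂ} (he : Integrable e) (h0 : ∀ u < 0, e u = 0) {σ : ℝ} (hσ : 0 ≤ σ) :
    Continuous (fun t => lap e (sv σ t)) := by
  simp only [lap_eq]; exact continuous_FT (integrable_damp he h0 hσ)

lemma continuous_F {σ : ℝ} (hσ : 0 ≤ σ) : Continuous (d.F σ) := by
  unfold F Fd
  have := continuous_lap d.ie d.e0 hσ
  have := continuous_lap d.ig d.g0 hσ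
  fun_prop

lemma tendsto_F (t : ℝ) : Tendsto (fun σ => d.F σ t) (𝓝[>] 0) (𝓝 (d.F 0 t)) := by
  unfold F Fd
  have h1 := tendsto_lap d.ie d.e0 t
  have h2 := tendsto_lap d.ig d.g0 t
  have h3 : Tendsto (fun σ => sv σ t) (𝓝[>] 0) (𝓝 (sv 0 t)) := by
    refine Tendsto.mono_left ?_ nhdsWithin_le_nhds
    refine Continuous.tendsto (f := fun σ : ℝ => sv σ t) ?_ 0
    unfold sv; fun_prop
  have h4 := h3.const_add 1
  exact (h4.mul ((h4.mul h1).add h2).cexp).const_mul _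

/-- bound for the argument of the exponential -/
noncomputable def Bd (t : ℝ) : ℝ :=
  (2 + 2 * Real.pi * |t|) * (∫ u, ‖d.e u‖) + ∫ u, ‖d.g u‖

lemma arg_bound {σ : ℝ} (hσ : 0 ≤ σ) (h1 : σ ≤ 1) (t : ℝ) :
    ‖(1 + sv σ t) * lap d.e (sv σ t) + lap d.g (sv σ t)‖ ≤ d.Bd t := by
  unfold Bd
  refine (norm_add_le _ _).trans ?_
  rw [norm_mul]
  gcongr
  · exact norm_sv_le hσ h1
  · exact norm_lap_le d.ie d.e0 hσ t
  · exact norm_lap_le d.ig d.g0 hσ t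

noncomputable def Fb (t : ℝ) : ℝ := Real.exp 1 * ((2 + 2 * Real.pi * |t|) * Real.exp (d.Bd t))

lemma continuous_Fb : Continuous d.Fb := by unfold Fb Bd; fun_prop

lemma norm_F_le {σ : ℝ} (hσ : 0 ≤ σ) (h1 : σ ≤ 1) (t : ℝ) : ‖d.F σ t‖ ≤ d.Fb t := by
  unfold F Fd Fb
  rw [norm_mul, norm_mul]
  gcongr
  · rw [Complex.norm_exp]; simp
  · exact norm_sv_le hσ h1
  · refine (Complex.norm_exp_le_exp_norm _).trans ?_
    gcongr
    exact d.arg_bound hσ h1 t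

end Dat

lemma fourier_facts {c : ℝ → ℂ} (hc : ContDiff ℝ (⊤ : ℕ∞) c) (hcs : HasCompactSupport c) :
    ∃ K : SchwartzMap ℝ ℂ, IF c = K ∧ FT K = c := by
  let f : SchwartzMap ℝ ℂ := hcs.toSchwartzMap hc
  have hf : (f : ℝ → ℂ) = c := rfl
  refine ⟨FourierTransformInv.fourierInv f, ?_, ?_⟩
  · rw [IF_eq, ← hf, SchwartzMap.fourierInv_coe]
  · rw [FT_eq, ← SchwartzMap.fourier_coe, FourierTransform.fourier_fourierInv_eq, hf]

lemma lintegral_enorm_ne_top {e : ℝ → ℂ} (he : Integrable e) : ∫⁻ u, ‖e u‖ₑ ≠ ⊤ := he.2.ne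

/-- existence of reproducing kernels -/
lemma dom_one_add (R : ℝ) (hR : 0 < R) : ∃ Q : ℝ → ENNReal, Measurable Q ∧ ∫⁻ u, Q u ≠ ⊤ ∧
    ∀ σ, 0 ≤ σ → σ ≤ 1 → ∃ a : ℝ → ℂ, Integrable a ∧ (∀ u, ‖a u‖ₑ ≤ Q u) ∧
      ∀ t ∈ Metric.closedBall (0 : ℝ) R, FT a t = 1 + sv σ t := by
  let χ : ContDiffBump (0 : ℝ) := ⟨R, R + 1, hR, by linarith⟩
  have hχ : ContDiff ℝ (⊤ : ℕ∞) (fun t => ((χ t : ℝ) : ℂ)) :=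
    Complex.ofRealCLM.contDiff.comp χ.contDiff
  have hχs : HasCompactSupport (fun t => ((χ t : ℝ) : ℂ)) :=
    χ.hasCompactSupport.comp_left (g := fun x : ℝ => (x : ℂ)) (by simp)
  obtain ⟨K1, -, h1⟩ := fourier_facts hχ hχs
  have hχ2 : ContDiff ℝ (⊤ : ℕ∞) (fun t : ℝ => ((χ t : ℝ) : ℂ) * (((2 * Real.pi * t : ℝ) : ℂ) * Complex.I)) := by
    refine hχ.mul (ContDiff.mul ?_ contDiff_const)
    exact Complex.ofRealCLM.contDiff.comp (contDiff_const.mul contDiff_id)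
  obtain ⟨K2, -, h2⟩ := fourier_facts hχ2 hχs.mul_right
  refine ⟨fun u => 2 * ‖K1 u‖ₑ + ‖K2 u‖ₑ, ?_, ?_, ?_⟩
  · have := K1.continuous; have := K2.continuous; fun_prop
  · have c1 := K1.continuous; have c2 := K2.continuous
    rw [lintegral_add_left (by fun_prop), lintegral_const_mul _ (by fun_prop)]
    exact ENNReal.add_ne_top.2 ⟨ENNReal.mul_ne_top (by simp) (lintegral_enorm_ne_top K1.integrable),
      lintegral_enorm_ne_top K2.integrable⟩
  · intro σ h0 hσ1
    have i1 : Integrable (fun u => ((1 + σ : ℝ) : ℂ) * K1 u) := K1.integrable.const_mul _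
    refine ⟨fun u => ((1 + σ : ℝ) : ℂ) * K1 u + K2 u, i1.add K2.integrable, ?_, ?_⟩
    · intro u
      refine (enorm_add_le _ _).trans ?_
      rw [enorm_mul]
      refine add_le_add (mul_le_mul' ?_ le_rfl) le_rfl
      rw [← ofReal_norm, Complex.norm_real, Real.norm_eq_abs, abs_of_nonneg (by linarith)]
      calc ENNReal.ofReal (1 + σ) ≤ ENNReal.ofReal 2 := ENNReal.ofReal_le_ofReal (by linarith)
        _ = 2 := by simp
    · intro t ht
      have e1 : FT (fun u => ((1 + σ : ℝ) : ℂ) * K1 u + K2 u) t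
          = ((1 + σ : ℝ) : ℂ) * FT K1 t + FT K2 t := by
        unfold FT
        rw [← integral_const_mul, ← integral_add]
        · congr 1; ext u; ring
        · exact (integrable_mul_ec K1.integrable (by fun_prop)).const_mul _
        · exact integrable_mul_ec K2.integrable (by fun_prop)
      rw [e1, h1, h2]
      beta_reduce
      rw [χ.one_of_mem_closedBall ht]
      unfold sv; push_cast; ring

namespace Dat
variable (d : Dat)

/-- Wiener-type domination. -/
lemma dom_F {c : ℝ → ℂ} (hc : ContDiff ℝ (⊤ : ℕ∞) c) (hcs : HasCompactSupport c) :
    ∃ D : ℝ → ℝ, Integrable D ∧ ∀ σ, 0 ≤ σ → σ ≤ 1 → ∀ᵐ y,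
      ‖IF (fun t => c t * d.F σ t) y‖ ≤ D y := by
  obtain ⟨R, hR, hR'⟩ : ∃ R > 0, tsupport c ⊆ Metric.closedBall 0 R := by
    obtain ⟨R, hR⟩ := hcs.isBounded.subset_closedBall 0
    exact ⟨max R 1, by positivity, hR.trans (Metric.closedBall_subset_closedBall (le_max_left _ _))⟩
  have h0 : ∀ t, t ∉ Metric.closedBall (0:ℝ) R → c t = 0 := fun t ht =>
    image_eq_zero_of_notMem_tsupport fun h => ht (hR' h)
  obtain ⟨Q, mQ, iQ, hQ⟩ := dom_one_add R hR
  obtain ⟨K, hK, -⟩ := fourier_facts hc hcs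
  -- measurable versions of ‖e‖, ‖g‖
  obtain ⟨E, mE, hE, iE⟩ : ∃ E : ℝ → ENNReal, Measurable E ∧ (∀ u, ‖d.e u‖ₑ ≤ E u) ∧ ∫⁻ u, E u ≠ ⊤ := by
    exact ⟨fun u => ‖d.e u‖ₑ, d.me.enorm, fun _ => le_rfl, lintegral_enorm_ne_top d.ie⟩
  obtain ⟨G, mG, hG, iG⟩ : ∃ E : ℝ → ENNReal, Measurable E ∧ (∀ u, ‖d.g u‖ₑ ≤ E u) ∧ ∫⁻ u, E u ≠ ⊤ := by
    exact ⟨fun u => ‖d.g u‖ₑ, d.mg.enorm, fun _ => le_rfl, lintegral_enorm_ne_top d.ig⟩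
  set Ka : ℝ → ENNReal := fun y => ‖K y‖ₑ with hKa
  have mK : Measurable Ka := by have := K.continuous; fun_prop
  have iK : ∫⁻ u, Ka u ≠ ⊤ := lintegral_enorm_ne_top K.integrable
  set D1 := cv Q Ka
  have mD1 : Measurable D1 := measurable_cv mQ mK
  have iD1 : ∫⁻ u, D1 u ≠ ⊤ := by rw [lintegral_cv mQ mK]; exact ENNReal.mul_ne_top iQ iK
  set a : ℝ → ENNReal := fun u => cv E Q u + G u
  have ma : Measurable a := (measurable_cv mE mQ).add mG
  have ia : ∫⁻ u, a u ≠ ⊤ := by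
    simp only [a]
    rw [lintegral_add_left (measurable_cv mE mQ), lintegral_cv mE mQ]
    exact ENNReal.add_ne_top.2 ⟨ENNReal.mul_ne_top iE iQ, iG⟩
  set D2 : ℝ → ENNReal := fun y => ENNReal.ofReal (Real.exp 1) * expD a D1 y
  have mD2 : Measurable D2 := (measurable_expD ma mD1).const_mul _
  have iD2 : ∫⁻ u, D2 u ≠ ⊤ := by
    simp only [D2]
    rw [lintegral_const_mul _ (measurable_expD ma mD1)]
    exact ENNReal.mul_ne_top (by simp) (lintegral_expD ma mD1 ia iD1)
  refine ⟨fun y => (D2 y).toReal, integrable_toReal_of_lintegral_ne_top mD2.aemeasurable iD2, ?_⟩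
  intro σ hσ hσ1
  filter_upwards [ae_lt_top mD2 iD2] with y hy
  obtain ⟨q, iq, hq, hq1⟩ := hQ σ hσ hσ1
  set S := Metric.closedBall (0 : ℝ) R
  have ctE := integrable_damp d.ie d.e0 hσ
  have ctG := integrable_damp d.ig d.g0 hσ
  have hle : ∀ {e : ℝ → ℂ} (_ : ∀ u < 0, e u = 0) {E : ℝ → ENNReal} (_ : ∀ u, ‖e u‖ₑ ≤ E u) (u : ℝ),
      ‖e u * (Real.exp (-(σ * u)) : ℂ)‖ₑ ≤ E u := by
    intro e h0 E hE u
    refine le_trans ?_ (hE u)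
    rw [← ofReal_norm, ← ofReal_norm]
    exact ENNReal.ofReal_le_ofReal (norm_damp_le h0 hσ u)
  have dE := dom_FT (S := S) ctE (hle d.e0 hE)
  have dG := dom_FT (S := S) ctG (hle d.g0 hG)
  have dQ := dom_FT (S := S) iq hq
  have dA := (dE.mul dQ (continuous_FT iq) mE mQ).add dG
    ((continuous_FT iq).mul (continuous_FT ctE)) (continuous_FT ctG) (measurable_cv mE mQ)
  have cA := ((continuous_FT iq).mul (continuous_FT ctE)).add (continuous_FT ctG)
  have hcc := hc.continuous
  have hDD : ∀ y, ‖IF (fun t => c t * FT q t) y‖ₑ ≤ D1 y := by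
    intro y
    have := dQ c hcc hcs h0 y
    rwa [hK] at this
  have key := dA.exp cA (c := fun t => c t * FT q t) (hcc.mul (continuous_FT iq)) hcs.mul_right
    (fun t ht => by simp [h0 t ht]) hDD y
  have e1 : IF (fun t => c t * d.F σ t) y = Complex.exp 1 * IF (fun t => c t * FT q t *
      Complex.exp (FT q t * FT (fun u => d.e u * (Real.exp (-(σ * u)) : ℂ)) t +
        FT (fun u => d.g u * (Real.exp (-(σ * u)) : ℂ)) t)) y := by
    unfold IF
    rw [← integral_const_mul]
    congr 1; ext t
    by_cases ht : t ∈ S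
    · beta_reduce
      rw [hq1 t ht, ← lap_eq, ← lap_eq]
      unfold F Fd; ring
    · simp [h0 t ht]
  rw [e1, ← toReal_enorm]
  refine ENNReal.toReal_mono hy.ne ?_
  rw [enorm_mul]
  simp only [D2]
  refine mul_le_mul' ?_ key
  rw [← ofReal_norm, Complex.norm_exp]; simp

end Dat

namespace Dat
variable (d : Dat)

lemma exp_split (σ t l : ℝ) : Complex.exp (-((1 + sv σ t) * l)) =
    (Real.exp (-((1 + σ) * l)) : ℂ) * ec (-(t * l)) := by
  unfold sv ec
  rw [Complex.ofReal_exp, ← Complex.exp_add]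
  congr 1; push_cast; ring

lemma summable_w {σ : ℝ} (hσ : 0 < σ) : Summable (fun i => Real.exp (-((1 + σ) * d.ℓ i))) := by
  have := (d.hZ σ 0 hσ).summable.norm
  refine this.congr fun i => ?_
  rw [exp_split, norm_mul, norm_ec, mul_one, Complex.norm_real, Real.norm_eq_abs, abs_of_pos (Real.exp_pos _)]

lemma hasSum_K {c : ℝ → ℂ} (hc : Integrable c) {σ : ℝ} (hσ : 0 < σ) (x : ℝ) :
    HasSum (fun i => (Real.exp (-((1 + σ) * d.ℓ i)) : ℂ) * IF c (x - d.ℓ i))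
      (∫ t, c t * ec (t * x) * (d.F σ t / sv σ t)) := by
  have := d.cnt
  have e1 : ∀ i, (Real.exp (-((1 + σ) * d.ℓ i)) : ℂ) * IF c (x - d.ℓ i) =
      ∫ t, c t * ec (t * x) * Complex.exp (-((1 + sv σ t) * d.ℓ i)) := by
    intro i
    unfold IF
    rw [← integral_const_mul]
    congr 1; ext t
    rw [exp_split, show t * (x - d.ℓ i) = t * x + -(t * d.ℓ i) by ring, ec_add]; ring
  simp_rw [e1]
  refine hasSum_integral_of_dominated_convergence
      (bound := fun i t => ‖c t‖ * Real.exp (-((1 + σ) * d.ℓ i))) ?_ ?_ ?_ ?_ ?_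
  · intro i
    exact (integrable_mul_ec hc (by fun_prop)).aestronglyMeasurable.mul
      (Continuous.aestronglyMeasurable (by fun_prop))
  · intro i; refine Eventually.of_forall fun t => ?_
    rw [exp_split, norm_mul, norm_mul, norm_mul, norm_ec, norm_ec, mul_one, mul_one,
      Complex.norm_real, Real.norm_eq_abs, abs_of_pos (Real.exp_pos _)]
  · exact Eventually.of_forall fun t => (d.summable_w hσ).mul_left _
  · simp_rw [tsum_mul_left]
    exact hc.norm.mul_const _
  · exact Eventually.of_forall fun t => (d.hZ σ t hσ).mul_left _

lemma inv_sv {σ : ℝ} (hσ : 0 < σ) (t : ℝ) :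
    (sv σ t)⁻¹ = ∫ v in Ioi (0:ℝ), (Real.exp (-(σ * v)) : ℂ) * ec (-(t * v)) := by
  have := integral_exp_mul_complex_Ioi (a := -sv σ t) (by simp [sv_re, hσ]) 0
  have h2 : ∀ v : ℝ, (Real.exp (-(σ * v)) : ℂ) * ec (-(t * v)) = Complex.exp (-sv σ t * v) := by
    intro v; rw [← exp_sv]; congr 1; ring
  simp_rw [h2, this]
  simp

lemma integral_swap {h : ℝ → ℂ} (hh : Integrable h) {σ : ℝ} (hσ : 0 < σ) (x : ℝ) :
    ∫ t, h t * ec (t * x) * (sv σ t)⁻¹ = ∫ v in Ioi (0:ℝ), (Real.exp (-(σ * v)) : ℂ) * IF h (x - v) := by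
  unfold IF
  simp_rw [inv_sv hσ, ← integral_const_mul]
  rw [integral_integral_swap]
  · congr 1; ext v
    congr 1; ext t
    rw [show t * (x - v) = t * x + -(t * v) by ring, ec_add]; ring
  · have h1 : Integrable (fun v : ℝ => (Real.exp (-(σ * v)) : ℂ)) (volume.restrict (Ioi 0)) := by
      have := integrableOn_exp_mul_Ioi (a := -σ) (by linarith) 0
      have h3 : IntegrableOn (fun v : ℝ => Real.exp (-(σ * v))) (Ioi 0) := by
        refine this.congr_fun (fun v _ => by ring_nf) measurableSet_Ioi
      exact h3.ofReal
    have h2 : Integrable (fun z : ℝ × ℝ => h z.1 * (Real.exp (-(σ * z.2)) : ℂ))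
      (volume.prod (volume.restrict (Ioi 0))) := hh.mul_prod h1
    have h3 := h2.mul_bdd (c := 1) (g := fun z : ℝ × ℝ => ec (z.1 * x) * ec (-(z.1 * z.2))) ?_ ?_
    · refine h3.congr (Eventually.of_forall fun z => ?_)
      simp only [Function.uncurry]; ring
    · apply Continuous.aestronglyMeasurable; fun_prop
    · exact Eventually.of_forall fun t => by simp [norm_ec]

section

lemma integrable_cF {c : ℝ → ℂ} (hc : ContDiff ℝ (⊤ : ℕ∞) c) (hcs : HasCompactSupport c)
    {σ : ℝ} (hσ : 0 ≤ σ) : Integrable (fun t => c t * d.F σ t) := by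
  have := hc.continuous
  have := d.continuous_F hσ
  exact Continuous.integrable_of_hasCompactSupport (by fun_prop) hcs.mul_right

lemma tendsto_G {c : ℝ → ℂ} (hc : ContDiff ℝ (⊤ : ℕ∞) c) (hcs : HasCompactSupport c)
    (y : ℝ) : Tendsto (fun σ => IF (fun t => c t * d.F σ t) y) (𝓝[>] 0)
    (𝓝 (IF (fun t => c t * d.F 0 t) y)) := by
  unfold IF
  have hsm : ∀ᶠ σ : ℝ in 𝓝[>] 0, 0 ≤ σ ∧ σ ≤ 1 := by
    filter_upwards [Ioo_mem_nhdsGT (zero_lt_one' ℝ)] with σ h using ⟨h.1.le, h.2.le⟩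
  have := hc.continuous
  have := d.continuous_Fb
  refine tendsto_integral_filter_of_dominated_convergence (fun t => ‖c t‖ * d.Fb t) ?_ ?_ ?_ ?_
  · filter_upwards [hsm] with σ h
    have := d.continuous_F h.1
    apply Continuous.aestronglyMeasurable; fun_prop
  · filter_upwards [hsm] with σ h
    refine Eventually.of_forall fun t => ?_
    rw [norm_mul, norm_mul, norm_ec, mul_one]
    gcongr
    exact d.norm_F_le h.1 h.2 t
  · exact Continuous.integrable_of_hasCompactSupport (by fun_prop) hcs.norm.mul_right
  · exact Eventually.of_forall fun t => ((d.tendsto_F t).const_mul _).mul_const _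

lemma sum_le {c : ℝ → ℂ} (hc : ContDiff ℝ (⊤ : ℕ∞) c) (hcs : HasCompactSupport c)
    {Kr : ℝ → ℝ} (hK : ∀ y, IF c y = Kr y) (hK0 : ∀ y, 0 ≤ Kr y) (T : Finset d.ι) (x : ℝ) :
    ∑ i ∈ T, Real.exp (-(d.ℓ i)) * Kr (x - d.ℓ i) ≤
      ‖∫ v in Ioi (0:ℝ), IF (fun t => c t * d.F 0 t) (x - v)‖ := by
  have hsm : ∀ᶠ σ : ℝ in 𝓝[>] 0, 0 < σ ∧ σ ≤ 1 := by
    filter_upwards [Ioo_mem_nhdsGT (zero_lt_one' ℝ)] with σ h using ⟨h.1, h.2.le⟩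
  obtain ⟨D, iD, hD⟩ := d.dom_F hc hcs
  have hci : Integrable c := hc.continuous.integrable_of_hasCompactSupport hcs
  have L : Tendsto (fun σ => ∑ i ∈ T, Real.exp (-((1 + σ) * d.ℓ i)) * Kr (x - d.ℓ i)) (𝓝[>] 0)
      (𝓝 (∑ i ∈ T, Real.exp (-(d.ℓ i)) * Kr (x - d.ℓ i))) := by
    refine Tendsto.mono_left ?_ nhdsWithin_le_nhds
    have := Continuous.tendsto (f := fun σ : ℝ => ∑ i ∈ T, Real.exp (-((1 + σ) * d.ℓ i)) * Kr (x - d.ℓ i))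
      (by fun_prop) 0
    simpa using this
  have Rt : Tendsto (fun σ : ℝ => ∫ v in Ioi (0:ℝ), (Real.exp (-(σ * v)) : ℂ) *
      IF (fun t => c t * d.F σ t) (x - v)) (𝓝[>] 0)
      (𝓝 (∫ v in Ioi (0:ℝ), IF (fun t => c t * d.F 0 t) (x - v))) := by
    refine tendsto_integral_filter_of_dominated_convergence (fun v => D (x - v)) ?_ ?_ ?_ ?_
    · filter_upwards [hsm] with σ h
      have := continuous_IF (d.integrable_cF hc hcs h.1.le)
      apply Continuous.aestronglyMeasurable; fun_prop
    · filter_upwards [hsm] with σ h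
      have h1 := hD σ h.1.le h.2
      have h2 : ∀ᵐ v, ‖IF (fun t => c t * d.F σ t) (x - v)‖ ≤ D (x - v) :=
        (Measure.measurePreserving_sub_left volume x).quasiMeasurePreserving.ae h1
      rw [ae_restrict_iff' measurableSet_Ioi]
      filter_upwards [h2] with v hv hv0
      rw [norm_mul, Complex.norm_real, Real.norm_eq_abs, abs_of_pos (Real.exp_pos _)]
      refine (mul_le_of_le_one_left (norm_nonneg _) ?_).trans hv
      rw [Real.exp_le_one_iff]
      have := mul_pos h.1 hv0
      linarith
    · exact (iD.comp_sub_left x).integrableOn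
    · refine Eventually.of_forall fun v => ?_
      have h1 : Tendsto (fun σ : ℝ => (Real.exp (-(σ * v)) : ℂ)) (𝓝[>] 0) (𝓝 1) := by
        refine Tendsto.mono_left ?_ nhdsWithin_le_nhds
        have := Continuous.tendsto (f := fun σ : ℝ => (Real.exp (-(σ * v)) : ℂ)) (by fun_prop) 0
        simpa using this
      simpa using h1.mul (d.tendsto_G hc hcs (x - v))
  refine le_of_tendsto_of_tendsto L Rt.norm ?_
  filter_upwards [hsm] with σ h
  have h1 := d.hasSum_K hci h.1 x
  have h2 : ∫ t, c t * ec (t * x) * (d.F σ t / sv σ t) = ∫ v in Ioi (0:ℝ), (Real.exp (-(σ * v)) : ℂ) *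
      IF (fun t => c t * d.F σ t) (x - v) := by
    rw [← integral_swap (d.integrable_cF hc hcs h.1.le) h.1]
    congr 1; ext t; rw [div_eq_mul_inv]; ring
  rw [h2] at h1
  rw [← h1.tsum_eq]
  have h3 : HasSum (fun i => Real.exp (-((1 + σ) * d.ℓ i)) * Kr (x - d.ℓ i))
      (∑' i, Real.exp (-((1 + σ) * d.ℓ i)) * Kr (x - d.ℓ i)) := by
    apply Summable.hasSum
    have := h1.summable
    simp_rw [hK, ← Complex.ofReal_mul] at this
    exact Complex.summable_ofReal.1 this
  simp_rw [hK, ← Complex.ofReal_mul]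
  rw [← Complex.ofReal_tsum, Complex.norm_real]
  refine le_trans ?_ (le_abs_self _)
  exact sum_le_hasSum _ (fun i _ => mul_nonneg (Real.exp_pos _).le (hK0 _)) h3

lemma tendsto_bound {c : ℝ → ℂ} (hc : ContDiff ℝ (⊤ : ℕ∞) c) (hcs : HasCompactSupport c)
    : Tendsto (fun x => ∫ v in Ioi (0:ℝ), IF (fun t => c t * d.F 0 t) (x - v)) atTop
    (𝓝 (c 0 * d.F 0 0)) := by
  obtain ⟨D, iD, hD⟩ := d.dom_F hc hcs
  have ic := d.integrable_cF hc hcs le_rfl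
  have cI := continuous_IF ic
  have iG : Integrable (IF (fun t => c t * d.F 0 t)) :=
    iD.mono' cI.aestronglyMeasurable (hD 0 le_rfl zero_le_one)
  have h1 : ∀ x, ∫ v in Ioi (0:ℝ), IF (fun t => c t * d.F 0 t) (x - v) =
      ∫ v in Iio x, IF (fun t => c t * d.F 0 t) v := by
    intro x
    rw [← integral_indicator measurableSet_Ioi, ← integral_indicator measurableSet_Iio,
      ← integral_sub_left_eq_self _ volume x]
    congr 1; ext v
    simp [indicator]
  simp_rw [h1]
  have h2 : ∫ v, IF (fun t => c t * d.F 0 t) v = c 0 * d.F 0 0 := by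
    have hcc := hc.continuous
    have hF := d.continuous_F le_rfl
    have h3 : FT (IF (fun t => c t * d.F 0 t)) = fun t => c t * d.F 0 t := by
      rw [FT_eq, IF_eq]
      refine Continuous.fourier_fourierInv_eq (by fun_prop) ic ?_
      rw [← FT_eq]
      refine iG.comp_neg.congr (Eventually.of_forall fun v => ?_)
      simp [IF, FT, mul_comm]
    have := congrFun h3 0
    simp only [FT, zero_mul, neg_zero, ec_zero, mul_one] at this
    exact this
  rw [← h2]
  exact (aecover_Iio tendsto_id).integral_tendsto_of_countably_generated iG

lemma eventually_sum_le {c : ℝ → ℂ} (hc : ContDiff ℝ (⊤ : ℕ∞) c) (hcs : HasCompactSupport c)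
    {Kr : ℝ → ℝ} (hK : ∀ y, IF c y = Kr y) (hK0 : ∀ y, 0 ≤ Kr y) :
    ∀ᶠ x in atTop, ∀ T : Finset d.ι, ∑ i ∈ T, Real.exp (-(d.ℓ i)) * Kr (x - d.ℓ i) ≤
      ‖c 0 * d.F 0 0‖ + 1 := by
  have := (d.tendsto_bound hc hcs).norm.eventually_le_const (lt_add_one _)
  filter_upwards [this] with x hx T
  exact (d.sum_le hc hcs hK hK0 T x).trans hx

end
end Dat

lemma exists_kernel : ∃ (κ : ℝ → ℂ) (Kr : ℝ → ℝ) (r c0 : ℝ), ContDiff ℝ (⊤ : ℕ∞) κ ∧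
    HasCompactSupport κ ∧ (∀ y, IF κ y = Kr y) ∧ (∀ y, 0 ≤ Kr y) ∧ 0 < r ∧ 0 < c0 ∧
    (∀ y, |y| ≤ r → c0 ≤ Kr y) := by
  let χ : ContDiffBump (0 : ℝ) := ⟨1, 2, by norm_num, by norm_num⟩
  set f : ℝ → ℂ := fun t => ((χ t : ℝ) : ℂ) with hf
  have hχ : ContDiff ℝ (⊤ : ℕ∞) f := Complex.ofRealCLM.contDiff.comp χ.contDiff
  have hχs : HasCompactSupport f :=
    χ.hasCompactSupport.comp_left (g := fun x : ℝ => (x : ℂ)) (by simp)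
  have hfi : Integrable f := hχ.continuous.integrable_of_hasCompactSupport hχs
  set κ : ℝ → ℂ := convolution f f (ContinuousLinearMap.mul ℝ ℂ) volume with hκ
  have hFT : FT κ = fun y => FT f y * FT f y := by
    rw [FT_eq, FT_eq]
    ext y
    exact Real.fourier_mul_convolution_eq hfi hfi y
  have hIF : ∀ y, IF κ y = FT κ (-y) := by
    intro y; simp [IF, FT, mul_comm]
  have hreal : ∀ y, FT f y = ((FT f y).re : ℂ) := by
    intro y
    symm
    rw [← Complex.conj_eq_iff_re]
    unfold FT
    rw [← integral_conj, ← integral_neg_eq_self]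
    congr 1; ext t
    have : (starRingEnd ℂ) (ec (-(y * -t))) = ec (-(y * t)) := by
      unfold ec
      rw [← Complex.exp_conj]; congr 1
      rw [map_mul, Complex.conj_ofReal, Complex.conj_I]; push_cast; ring
    rw [map_mul, this]
    congr 1
    simp only [hf, Complex.conj_ofReal]
    rw [χ.neg]
  have hcont : Continuous (fun y => (FT f y).re) := Complex.continuous_re.comp (continuous_FT hfi)
  refine ⟨κ, fun y => (FT f (-y)).re ^ 2, ?_⟩
  have hpos : 0 < (FT f (-0)).re ^ 2 := by
    have : FT f (-0) = ((∫ t, χ t : ℝ) : ℂ) := by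
      simp only [FT, hf, neg_zero, zero_mul, ec_zero, mul_one]
      exact integral_ofReal
    rw [this, Complex.ofReal_re]
    have := χ.integral_pos (μ := volume)
    positivity
  have hc2 : Continuous (fun y => (FT f (-y)).re ^ 2) := (hcont.comp continuous_neg).pow 2
  have hev := hc2.continuousAt.eventually_const_lt (half_lt_self hpos)
  obtain ⟨ε, hε, h⟩ := Metric.eventually_nhds_iff.1 hev
  refine ⟨ε / 2, (FT f (-0)).re ^ 2 / 2, ?_, ?_, ?_, ?_, by positivity, by positivity, ?_⟩
  · exact hχs.contDiff_convolution_right _ hfi.locallyIntegrable hχ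
  · exact hχs.convolution _ hχs
  · intro y
    rw [hIF, hFT]
    beta_reduce
    rw [hreal (-y)]
    push_cast; rw [Complex.ofReal_re]; ring
  · intro y; positivity
  · intro y hy
    refine (h ?_).le
    rw [Real.dist_eq, sub_zero]; linarith

lemma IF_scale (c : ℝ → ℂ) {L : ℝ} (hL : 0 < L) (y : ℝ) :
    IF (fun t => c (t / L)) y = L * IF c (L * y) := by
  unfold IF
  have := Measure.integral_comp_div (fun t => c t * ec (t * (L * y))) L
  rw [abs_of_pos hL] at this
  simp only [Complex.real_smul] at this
  rw [← this]
  congr 1; ext t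
  congr 2; field_simp

namespace Dat
variable (d : Dat)

lemma finite_T (u : ℝ) : {i | d.ℓ i ≤ u}.Finite := by
  have h := d.summable_w (σ := 1) one_pos
  have h2 := h.tendsto_cofinite_zero
  have h3 := h2.eventually_lt_const (Real.exp_pos (-((1 + 1) * u)))
  rw [eventually_cofinite] at h3
  refine h3.subset fun i hi => ?_
  simp only [mem_ofPred_eq, not_lt, Real.exp_le_exp] at *
  linarith

noncomputable def T (u : ℝ) : Finset d.ι := (d.finite_T u).toFinset

lemma mem_T {u : ℝ} {i : d.ι} : i ∈ d.T u ↔ d.ℓ i ≤ u := by simp [T]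

lemma T_mono {u v : ℝ} (h : u ≤ v) : d.T u ⊆ d.T v := by
  intro i hi; rw [mem_T] at *; linarith

noncomputable def b (u : ℝ) : ℝ := ∑ i ∈ d.T u, d.μ i * Real.exp (-d.ℓ i)

lemma measurable_b : Measurable d.b := by
  have h1 : Monotone (fun u => ∑ i ∈ d.T u, (1 + d.μ i) * Real.exp (-d.ℓ i)) := by
    intro u v h
    refine Finset.sum_le_sum_of_subset_of_nonneg (d.T_mono h) fun i _ _ => ?_
    have := neg_le_of_abs_le (d.μ1 i)
    exact mul_nonneg (by linarith) (Real.exp_pos _).le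
  have h2 : Monotone (fun u => ∑ i ∈ d.T u, Real.exp (-d.ℓ i)) := by
    intro u v h
    exact Finset.sum_le_sum_of_subset_of_nonneg (d.T_mono h) fun i _ _ => (Real.exp_pos _).le
  have : d.b = fun u => (∑ i ∈ d.T u, (1 + d.μ i) * Real.exp (-d.ℓ i)) - ∑ i ∈ d.T u, Real.exp (-d.ℓ i) := by
    ext u; unfold b; rw [← Finset.sum_sub_distrib]; congr 1; ext i; ring
  rw [this]
  exact h1.measurable.sub h2.measurable

lemma b_neg {u : ℝ} (h : u < 0) : d.b u = 0 := by
  unfold b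
  have : d.T u = ∅ := by
    ext i; rw [mem_T]; have := d.ℓ0 i; simp; linarith
  rw [this]; simp

lemma b_bound_le {u X : ℝ} (h : u ≤ X) : |d.b u| ≤ ∑ i ∈ d.T X, Real.exp (-d.ℓ i) := by
  unfold b
  refine (Finset.abs_sum_le_sum_abs _ _).trans ?_
  refine (Finset.sum_le_sum (g := fun i => Real.exp (-d.ℓ i)) fun i _ => ?_).trans
    (Finset.sum_le_sum_of_subset_of_nonneg (d.T_mono h) fun i _ _ => (Real.exp_pos _).le)
  rw [abs_mul, abs_of_pos (Real.exp_pos _)]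
  exact mul_le_of_le_one_left (Real.exp_pos _).le (d.μ1 i)

lemma b_diff {x y : ℝ} (h : x ≤ y) : |d.b y - d.b x| ≤ ∑ i ∈ d.T y \ d.T x, Real.exp (-d.ℓ i) := by
  unfold b
  rw [← Finset.sum_sdiff (d.T_mono h), add_sub_cancel_right]
  refine (Finset.abs_sum_le_sum_abs _ _).trans ?_
  refine Finset.sum_le_sum fun i _ => ?_
  rw [abs_mul, abs_of_pos (Real.exp_pos _)]
  exact mul_le_of_le_one_left (Real.exp_pos _).le (d.μ1 i)

lemma mass : ∃ C : ℝ, 0 ≤ C ∧ ∀ L : ℝ, 0 < L → ∀ᶠ x in atTop, ∀ T : Finset d.ι,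
    (∀ i ∈ T, |x - d.ℓ i| ≤ 1 / L) → ∑ i ∈ T, Real.exp (-d.ℓ i) ≤ C / L := by
  obtain ⟨κ, Kr, r, c0, hκ, hκs, hK, hK0, hr, hc0, hlow⟩ := exists_kernel
  refine ⟨(‖κ 0 * d.F 0 0‖ + 1) / (r * c0), by positivity, fun L hL => ?_⟩
  have hrL : 0 < r * L := by positivity
  have h1 : ContDiff ℝ (⊤ : ℕ∞) (fun t => κ (t / (r * L))) := hκ.comp (contDiff_id.div_const _)
  have h2 : HasCompactSupport (fun t => κ (t / (r * L))) := by
    have := hκs.comp_homeomorph (Homeomorph.mulRight₀ (r * L)⁻¹ (by positivity))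
    exact this
  have h3 : ∀ y, IF (fun t => κ (t / (r * L))) y = ((r * L * Kr (r * L * y) : ℝ) : ℂ) := by
    intro y; rw [IF_scale κ hrL, hK]; push_cast; ring
  have := d.eventually_sum_le h1 h2 (Kr := fun y => r * L * Kr (r * L * y)) h3
    (fun y => mul_nonneg hrL.le (hK0 _))
  filter_upwards [this] with x hx T hT
  have hx := hx T
  rw [zero_div] at hx
  rw [div_div, le_div_iff₀ (by positivity), Finset.sum_mul]
  refine le_trans (Finset.sum_le_sum fun i hi => ?_) hx
  have h5 := hlow (r * L * (x - d.ℓ i)) (by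
    rw [abs_mul, abs_of_pos hrL]
    calc r * L * |x - d.ℓ i| ≤ r * L * (1 / L) := by gcongr; exact hT i hi
      _ = r := by field_simp)
  refine mul_le_mul_of_nonneg_left ?_ (Real.exp_pos _).le
  calc r * c0 * L = r * L * c0 := by ring
    _ ≤ _ := by gcongr

lemma slow : ∃ C : ℝ, 0 ≤ C ∧ ∀ L : ℝ, 0 < L → ∃ X : ℝ, 0 ≤ X ∧ ∀ x y, X ≤ x → x ≤ y →
    |d.b y - d.b x| ≤ C * (y - x + 1 / L) := by
  obtain ⟨C, hC, h⟩ := d.mass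
  refine ⟨C, hC, fun L hL => ?_⟩
  obtain ⟨X, hX⟩ := eventually_atTop.1 (h L hL)
  refine ⟨max X 0, le_max_right _ _, ?_⟩
  have step : ∀ x y, max X 0 ≤ x → x ≤ y → y ≤ x + 1 / L → |d.b y - d.b x| ≤ C / L := by
    intro x y hx hxy hy
    refine (d.b_diff hxy).trans (hX x ((le_max_left _ _).trans hx) _ fun i hi => ?_)
    rw [Finset.mem_sdiff, mem_T, mem_T, not_le] at hi
    rw [abs_le]; constructor <;> linarith [hi.1, hi.2, one_div_pos.2 hL]
  have ind : ∀ n : ℕ, ∀ x y, max X 0 ≤ x → x ≤ y → y ≤ x + n / L → |d.b y - d.b x| ≤ C * n / L := by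
    intro n
    induction n with
    | zero =>
      intro x y hx hxy hy
      have : y = x := by simp at hy; linarith
      simp [this]
    | succ n ih =>
      intro x y hx hxy hy
      push_cast at *
      rw [add_div] at hy
      have hL1 := one_div_pos.2 hL
      rcases le_total y (x + 1 / L) with h1 | h1
      · refine (step x y hx hxy h1).trans ?_
        gcongr
        have : 0 ≤ C * n := by positivity
        linarith
      · have a1 := step x (x + 1 / L) hx (by linarith) le_rfl
        have a2 := ih (x + 1 / L) y (by linarith) h1 (by linarith)
        have a3 := abs_sub_le (d.b y) (d.b (x + 1 / L)) (d.b x)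
        have : C * (n + 1) / L = C * n / L + C / L := by ring
        linarith
  intro x y hx hxy
  have h0 : 0 ≤ (y - x) * L := mul_nonneg (by linarith) hL.le
  have h1 := Nat.le_ceil ((y - x) * L)
  have h2 := (Nat.ceil_lt_add_one h0).le
  refine (ind ⌈(y - x) * L⌉₊ x y hx hxy ?_).trans ?_
  · rw [← sub_le_iff_le_add', le_div_iff₀ hL]; exact h1
  · rw [mul_div_assoc]
    gcongr
    rw [div_le_iff₀ hL, add_mul]
    have : 1 / L * L = 1 := by field_simp
    linarith

lemma growth : ∃ C : ℝ, 0 ≤ C ∧ ∀ u, |d.b u| ≤ C * (1 + |u|) := by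
  obtain ⟨C, hC, h⟩ := d.slow
  obtain ⟨X, hX0, hX⟩ := h 1 one_pos
  set M := ∑ i ∈ d.T X, Real.exp (-d.ℓ i)
  have hM : 0 ≤ M := Finset.sum_nonneg fun i _ => (Real.exp_pos _).le
  refine ⟨M + C, by positivity, fun u => ?_⟩
  have hu := abs_nonneg u
  rcases le_total u X with h1 | h1
  · have := d.b_bound_le h1
    nlinarith [mul_nonneg hM hu, mul_nonneg hC hu]
  · have a1 := d.b_bound_le (le_refl X)
    have a2 := hX X u le_rfl h1
    have a3 := abs_sub_abs_le_abs_sub (d.b u) (d.b X)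
    have a4 := le_abs_self u
    have a5 : C * (u - X + 1 / 1) ≤ C * (1 + |u|) := mul_le_mul_of_nonneg_left (by rw [div_one]; linarith) hC
    nlinarith [mul_nonneg hM hu]

end Dat

namespace Dat
variable (d : Dat)

lemma integrable_exp_sv {σ : ℝ} (hσ : 0 < σ) (t a : ℝ) :
    IntegrableOn (fun u : ℝ => Complex.exp (-sv σ t * u)) (Ioi a) :=
  integrableOn_exp_mul_complex_Ioi (by simp [sv_re, hσ]) a

lemma lap_b {σ : ℝ} (hσ : 0 < σ) (t : ℝ) :
    ∫ u, (d.b u : ℂ) * Complex.exp (-sv σ t * u) = (d.F σ t)⁻¹ := by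
  have := d.cnt
  set s := sv σ t with hs
  have hs0 : s ≠ 0 := sv_ne_zero hσ
  let f : d.ι → ℝ → ℂ := fun i => (Ioi (d.ℓ i)).indicator
    (fun u => ((d.μ i * Real.exp (-d.ℓ i) : ℝ) : ℂ) * Complex.exp (-s * u))
  have hfi : ∀ i, Integrable (f i) := fun i =>
    IntegrableOn.integrable_indicator (Integrable.const_mul (integrable_exp_sv hσ t (d.ℓ i)) _)
      measurableSet_Ioi
  have hint : ∀ i, ∫ u, f i u = s⁻¹ * ((d.μ i : ℂ) * Complex.exp (-((1 + s) * d.ℓ i))) := by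
    intro i
    simp only [f]
    rw [integral_indicator measurableSet_Ioi, integral_const_mul,
      integral_exp_mul_complex_Ioi (by simp [hs, sv_re, hσ])]
    push_cast
    rw [show -((1 + s) * (d.ℓ i : ℂ)) = -(d.ℓ i : ℂ) + -s * d.ℓ i by ring, Complex.exp_add]
    field_simp
  have hnorm : ∀ i, ∫ u, ‖f i u‖ ≤ σ⁻¹ * Real.exp (-((1 + σ) * d.ℓ i)) := by
    intro i
    have e1 : ∀ u, ‖f i u‖ = (Ioi (d.ℓ i)).indicator
        (fun u => (|d.μ i| * Real.exp (-d.ℓ i)) * Real.exp (-σ * u)) u := by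
      intro u
      simp only [f]
      rw [norm_indicator_eq_indicator_norm]
      congr 1; ext u
      rw [norm_mul, Complex.norm_real, Real.norm_eq_abs, abs_mul, abs_of_pos (Real.exp_pos _),
        Complex.norm_exp]
      congr 2
      simp [hs, sv]
    simp_rw [e1]
    rw [integral_indicator measurableSet_Ioi, integral_const_mul,
      integral_exp_mul_Ioi (by linarith)]
    rw [show -((1 + σ) * (d.ℓ i)) = -(d.ℓ i) + -σ * d.ℓ i by ring, Real.exp_add]
    rw [neg_div_neg_eq, div_eq_inv_mul]
    have h1 := mul_le_of_le_one_left (mul_nonneg (Real.exp_pos (-d.ℓ i)).le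
      (mul_nonneg (inv_nonneg.2 hσ.le) (Real.exp_pos (-σ * d.ℓ i)).le)) (d.μ1 i)
    nlinarith [h1]
  have hsum : Summable fun i => ∫ u, ‖f i u‖ :=
    Summable.of_nonneg_of_le (fun i => integral_nonneg fun u => norm_nonneg _) hnorm
      ((d.summable_w hσ).mul_left _)
  have h1 := hasSum_integral_of_summable_integral_norm hfi hsum
  simp_rw [hint] at h1
  have h2 := (d.hM σ t hσ).mul_left s⁻¹
  have h3 := h1.unique h2
  have h4 : s⁻¹ * (s / Fd d.e d.g s) = (d.F σ t)⁻¹ := by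
    unfold F; rw [← hs]; field_simp
  rw [← hs, h4] at h3
  rw [← h3]
  refine integral_congr_ae ?_
  have hae : ∀ᵐ u : ℝ, ∀ i, u ≠ d.ℓ i := by
    rw [ae_all_iff]; intro i
    exact Measure.ae_ne volume _
  filter_upwards [hae] with u hu
  rw [tsum_eq_sum (s := d.T u)]
  · unfold b; push_cast
    rw [Finset.sum_mul]
    refine Finset.sum_congr rfl fun i hi => ?_
    rw [mem_T] at hi
    have : d.ℓ i < u := lt_of_le_of_ne hi (hu i).symm
    simp [f, this]
  · intro i hi
    rw [mem_T, not_le] at hi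
    simp [f, hi.le]

lemma integrable_b_exp {σ : ℝ} (hσ : 0 < σ) :
    Integrable (fun u => (d.b u : ℂ) * (Real.exp (-(σ * u)) : ℂ)) := by
  obtain ⟨C, hC, h⟩ := d.growth
  have h1 : IntegrableOn (fun u : ℝ => C * (Real.exp (-(σ * u)) + (u * Real.exp (-(σ * u))))) (Ioi 0) := by
    refine Integrable.const_mul (Integrable.add ?_ ?_) _
    · refine (integrableOn_exp_mul_Ioi (a := -σ) (by linarith) 0).congr_fun (fun v _ => by ring_nf) measurableSet_Ioi
    · have := integrableOn_rpow_mul_exp_neg_mul_rpow (s := 1) (p := 1) (b := σ) (by norm_num) one_pos hσ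
      refine this.congr_fun (fun v _ => by simp) measurableSet_Ioi
  have h2 := h1.integrable_indicator measurableSet_Ioi
  refine h2.mono' ?_ ?_
  · exact (Complex.measurable_ofReal.comp d.measurable_b).aestronglyMeasurable.mul
      (Continuous.aestronglyMeasurable (by fun_prop))
  · filter_upwards [Measure.ae_ne volume (0:ℝ)] with u hu
    rw [norm_mul, Complex.norm_real, Complex.norm_real, Real.norm_eq_abs, Real.norm_eq_abs,
      abs_of_pos (Real.exp_pos _)]
    rcases lt_or_gt_of_ne hu with h0 | h0
    · rw [d.b_neg h0]; simp [indicator, not_lt.2 h0.le]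
    · simp only [indicator, mem_Ioi, h0, if_true]
      have := h u
      rw [abs_of_pos h0] at this
      have := mul_le_mul_of_nonneg_right this (Real.exp_pos (-(σ * u))).le
      linarith

lemma smooth_id {c : ℝ → ℂ} (hc : Integrable c) {σ : ℝ} (hσ : 0 < σ) (x : ℝ) :
    ∫ u, (d.b u : ℂ) * (Real.exp (-(σ * u)) : ℂ) * IF c (x - u) = IF (fun t => c t * (d.F σ t)⁻¹) x := by
  have h : FT (fun u => (d.b u : ℂ) * (Real.exp (-(σ * u)) : ℂ)) = fun t => (d.F σ t)⁻¹ := by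
    ext t
    rw [← d.lap_b hσ t]
    unfold FT
    congr 1; ext u
    rw [neg_mul, exp_sv]; ring
  rw [← IF_mul_FT hc (d.integrable_b_exp hσ), h]

lemma F_ne_zero {σ : ℝ} (hσ : 0 ≤ σ) (t : ℝ) : d.F σ t ≠ 0 := by
  unfold F Fd
  have : 1 + sv σ t ≠ 0 := by
    intro h
    have := congrArg Complex.re h
    simp [sv_re] at this; linarith
  refine mul_ne_zero (Complex.exp_ne_zero _) (mul_ne_zero this (Complex.exp_ne_zero _))

lemma norm_Finv_le {σ : ℝ} (hσ : 0 ≤ σ) (h1 : σ ≤ 1) (t : ℝ) : ‖(d.F σ t)⁻¹‖ ≤ Real.exp (d.Bd t) := by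
  unfold F Fd
  rw [mul_inv, mul_inv, ← Complex.exp_neg, ← Complex.exp_neg, norm_mul, norm_mul]
  have a1 : ‖Complex.exp (-1)‖ ≤ 1 := by
    rw [Complex.norm_exp]; simp
  have a2 : ‖(1 + sv σ t)⁻¹‖ ≤ 1 := by
    rw [norm_inv]; apply inv_le_one_of_one_le₀
    refine le_trans ?_ (Complex.abs_re_le_norm _)
    simp only [Complex.add_re, Complex.one_re, sv_re]
    rw [abs_of_nonneg] <;> linarith
  have a3 : ‖Complex.exp (-((1 + sv σ t) * lap d.e (sv σ t) + lap d.g (sv σ t)))‖ ≤ Real.exp (d.Bd t) := by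
    refine (Complex.norm_exp_le_exp_norm _).trans ?_
    rw [norm_neg]
    gcongr
    exact d.arg_bound hσ h1 t
  calc _ ≤ 1 * (1 * Real.exp (d.Bd t)) := by gcongr
    _ = _ := by ring

lemma smooth_lim {c : ℝ → ℂ} (hc : ContDiff ℝ (⊤ : ℕ∞) c) (hcs : HasCompactSupport c) (x : ℝ) :
    ∫ u, (d.b u : ℂ) * IF c (x - u) = IF (fun t => c t * (d.F 0 t)⁻¹) x := by
  have hsm : ∀ᶠ σ : ℝ in 𝓝[>] 0, 0 < σ ∧ σ ≤ 1 := by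
    filter_upwards [Ioo_mem_nhdsGT (zero_lt_one' ℝ)] with σ h using ⟨h.1, h.2.le⟩
  have hci : Integrable c := hc.continuous.integrable_of_hasCompactSupport hcs
  have hcc := hc.continuous
  obtain ⟨K, hK, -⟩ := fourier_facts hc hcs
  obtain ⟨C, hC, hb⟩ := d.growth
  have hKi : ∀ n : ℕ, Integrable (fun y => ‖y‖ ^ n * ‖K y‖) := fun n => K.integrable_pow_mul volume n
  have L : Tendsto (fun σ : ℝ => ∫ u, (d.b u : ℂ) * (Real.exp (-(σ * u)) : ℂ) * IF c (x - u)) (𝓝[>] 0)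
      (𝓝 (∫ u, (d.b u : ℂ) * IF c (x - u))) := by
    have hbd : Integrable (fun y => C * ((1 + |x|) * (‖y‖ ^ 0 * ‖K y‖) + ‖y‖ ^ 1 * ‖K y‖)) :=
      (((hKi 0).const_mul _).add (hKi 1)).const_mul _
    refine tendsto_integral_filter_of_dominated_convergence _ ?_ ?_ (hbd.comp_sub_left x) ?_
    · refine Eventually.of_forall fun σ => ?_
      have := continuous_IF hci
      refine AEStronglyMeasurable.mul (AEStronglyMeasurable.mul ?_ ?_) ?_
      · exact (Complex.measurable_ofReal.comp d.measurable_b).aestronglyMeasurable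
      · apply Continuous.aestronglyMeasurable; fun_prop
      · apply Continuous.aestronglyMeasurable; fun_prop
    · filter_upwards [hsm] with σ h
      refine Eventually.of_forall fun u => ?_
      rw [norm_mul, norm_mul, Complex.norm_real, Complex.norm_real, Real.norm_eq_abs, Real.norm_eq_abs,
        abs_of_pos (Real.exp_pos _), hK]
      have h1 : |d.b u| * Real.exp (-(σ * u)) ≤ C * (1 + |x| + |x - u|) := by
        rcases lt_or_ge u 0 with h0 | h0
        · rw [d.b_neg h0]; simp; positivity
        · have : Real.exp (-(σ * u)) ≤ 1 := by
            rw [Real.exp_le_one_iff]; have := mul_nonneg h.1.le h0; linarith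
          refine (mul_le_of_le_one_right (abs_nonneg _) this).trans ((hb u).trans ?_)
          have := abs_sub_abs_le_abs_sub u x
          rw [abs_sub_comm] at this
          exact mul_le_mul_of_nonneg_left (by linarith) hC
      calc _ ≤ C * (1 + |x| + |x - u|) * ‖K (x - u)‖ := by gcongr
        _ = _ := by simp only [Real.norm_eq_abs]; ring
    · refine Eventually.of_forall fun u => ?_
      have h1 : Tendsto (fun σ : ℝ => (Real.exp (-(σ * u)) : ℂ)) (𝓝[>] 0) (𝓝 1) := by
        refine Tendsto.mono_left ?_ nhdsWithin_le_nhds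
        have := Continuous.tendsto (f := fun σ : ℝ => (Real.exp (-(σ * u)) : ℂ)) (by fun_prop) 0
        simpa using this
      simpa using (h1.const_mul (d.b u : ℂ)).mul_const (IF c (x - u))
  have R : Tendsto (fun σ : ℝ => IF (fun t => c t * (d.F σ t)⁻¹) x) (𝓝[>] 0)
      (𝓝 (IF (fun t => c t * (d.F 0 t)⁻¹) x)) := by
    unfold IF
    have : Continuous d.Bd := by unfold Bd; fun_prop
    refine tendsto_integral_filter_of_dominated_convergence (fun t => ‖c t‖ * Real.exp (d.Bd t)) ?_ ?_ ?_ ?_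
    · filter_upwards [hsm] with σ h
      have := (d.continuous_F h.1.le).inv₀ (d.F_ne_zero h.1.le)
      exact ((hcc.mul this).mul (by fun_prop)).aestronglyMeasurable
    · filter_upwards [hsm] with σ h
      refine Eventually.of_forall fun t => ?_
      rw [norm_mul, norm_mul, norm_ec, mul_one]
      gcongr
      exact d.norm_Finv_le h.1.le h.2 t
    · exact Continuous.integrable_of_hasCompactSupport (by fun_prop) hcs.norm.mul_right
    · exact Eventually.of_forall fun t =>
        (((d.tendsto_F t).inv₀ (d.F_ne_zero le_rfl t)).const_mul _).mul_const _
  refine tendsto_nhds_unique (L.congr' ?_) R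
  filter_upwards [hsm] with σ h
  exact d.smooth_id hci h.1 x

lemma smooth_tendsto {c : ℝ → ℂ} (hc : ContDiff ℝ (⊤ : ℕ∞) c) (hcs : HasCompactSupport c) :
    Tendsto (fun x => ∫ u, (d.b u : ℂ) * IF c (x - u)) atTop (𝓝 0) := by
  simp_rw [d.smooth_lim hc hcs]
  have h1 := (Real.zero_at_infty_fourier (fun t => c t * (d.F 0 t)⁻¹))
  have h2 : ∀ x, IF (fun t => c t * (d.F 0 t)⁻¹) x = FT (fun t => c t * (d.F 0 t)⁻¹) (-x) := by
    intro x; simp [IF, FT, mul_comm]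
  simp_rw [h2, FT_eq]
  exact (h1.mono_left atBot_le_cocompact).comp tendsto_neg_atTop_atBot

lemma shift_bound : ∃ C : ℝ, 0 ≤ C ∧ ∀ L : ℝ, 0 < L → ∃ X M : ℝ, 0 ≤ M ∧ ∀ x, X < x → ∀ y,
    |d.b x - d.b (x - y / L)| ≤ (|y| + 1) * (C / L + 2 * M / (L * (x - X))) := by
  obtain ⟨C, hC, h⟩ := d.slow
  refine ⟨C, hC, fun L hL => ?_⟩
  obtain ⟨X, hX0, hX⟩ := h L hL
  set M := ∑ i ∈ d.T X, Real.exp (-d.ℓ i)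
  have hM : 0 ≤ M := Finset.sum_nonneg fun i _ => (Real.exp_pos _).le
  refine ⟨X, M, hM, fun x hx y => ?_⟩
  have hxX : 0 < x - X := sub_pos.2 hx
  have hy := abs_nonneg y
  have e0 : 0 ≤ (|y| + 1) * (2 * M / (L * (x - X))) := by positivity
  have hyL : y / L ≤ |y| / L := by gcongr; exact le_abs_self y
  have hyL' : -y / L ≤ |y| / L := by gcongr; exact neg_le_abs y
  have e1 : C * (|y| / L + 1 / L) = (|y| + 1) * (C / L) := by ring
  rcases le_or_gt X (x - y / L) with h1 | h1
  · have : |d.b x - d.b (x - y / L)| ≤ C * (|y| / L + 1 / L) := by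
      rcases le_total 0 y with h2 | h2
      · have h3 : 0 ≤ y / L := by positivity
        refine (hX _ x h1 (by linarith)).trans ?_
        exact mul_le_mul_of_nonneg_left (by linarith) hC
      · have h3 : y / L ≤ 0 := div_nonpos_of_nonpos_of_nonneg h2 hL.le
        rw [abs_sub_comm]
        refine (hX x _ hx.le (by linarith)).trans ?_
        rw [neg_div] at hyL'
        exact mul_le_mul_of_nonneg_left (by linarith) hC
    rw [mul_add]; linarith
  · have a1 := d.b_bound_le (le_refl X)
    have a2 := hX X x le_rfl hx.le
    have a3 := d.b_bound_le h1.le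
    have a4 : C * (x - X + 1 / L) ≤ C * (|y| / L + 1 / L) :=
      mul_le_mul_of_nonneg_left (by linarith) hC
    have a5 : 2 * M ≤ (|y| + 1) * (2 * M / (L * (x - X))) := by
      have : L * (x - X) ≤ |y| + 1 := by
        have : x - X ≤ |y| / L := by linarith
        rw [le_div_iff₀ hL] at this; linarith
      rw [mul_div_assoc', le_div_iff₀ (by positivity)]
      have := mul_le_mul_of_nonneg_left this (by linarith : 0 ≤ 2 * M)
      linarith
    have a6 : |d.b x - d.b (x - y / L)| ≤ |d.b x - d.b X| + |d.b X| + |d.b (x - y / L)| := by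
      have t1 := abs_sub (d.b x - d.b X + d.b X) (d.b (x - y / L))
      have t2 := abs_add_le (d.b x - d.b X) (d.b X)
      rw [sub_add_cancel] at t1 t2
      linarith
    rw [mul_add]; linarith

theorem tendsto_b : Tendsto d.b atTop (𝓝 0) := by
  obtain ⟨κ, Kr, r, c0, hκ, hκs, hK, hK0, hr, hc0, hlow⟩ := exists_kernel
  obtain ⟨K, hKK, -⟩ := fourier_facts hκ hκs
  have hKr : ∀ y, (K y : ℂ) = Kr y := fun y => by rw [← hKK, hK]
  have hnK : ∀ y, ‖K y‖ = Kr y := fun y => by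
    rw [hKr, Complex.norm_real, Real.norm_eq_abs, abs_of_nonneg (hK0 y)]
  have i0 : Integrable Kr := by
    have := K.integrable_pow_mul volume 0
    simpa [hnK] using this
  have i1 : Integrable (fun y => |y| * Kr y) := by
    have := K.integrable_pow_mul volume 1
    simpa [hnK] using this
  have iA : Integrable (fun y => (|y| + 1) * Kr y) := by
    refine (i1.add i0).congr (Eventually.of_forall fun y => ?_)
    simp only [Pi.add_apply]; ring
  set A := ∫ y, (|y| + 1) * Kr y with hA
  have hA0 : 0 ≤ A := integral_nonneg fun y => mul_nonneg (by positivity) (hK0 y)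
  set I0 := ∫ y, Kr y with hI0
  have hI : 0 < I0 := by
    have h1 : ∫ y in Icc (-r) r, c0 ≤ ∫ y in Icc (-r) r, Kr y := by
      refine setIntegral_mono_on (by simp) i0.integrableOn measurableSet_Icc fun y hy => ?_
      exact hlow y (abs_le.2 hy)
    have h2 : ∫ y in Icc (-r) r, Kr y ≤ I0 := setIntegral_le_integral i0 (Eventually.of_forall hK0)
    have h3 : ∫ y in Icc (-r) r, c0 = 2 * r * c0 := by
      simp [hr.le]; left; ring
    rw [h3] at h1
    have : 0 < 2 * r * c0 := by positivity
    linarith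
  obtain ⟨C, hC, hsh⟩ := d.shift_bound
  obtain ⟨C', hC', hgr⟩ := d.growth
  rw [Metric.tendsto_nhds]
  intro ε hε
  set η := I0 * ε / (3 * (A + 1)) with hη
  have hη0 : 0 < η := by positivity
  set L := (C + 1) / η with hLdef
  have hL : 0 < L := by positivity
  obtain ⟨X, M, hM, hb⟩ := hsh L hL
  have hrep : ∀ x, ∫ u, (d.b u : ℂ) * IF (fun t => κ (t / L)) (x - u) =
      ((∫ y, d.b (x - y / L) * Kr y : ℝ) : ℂ) := by
    intro x
    have e1 := Measure.integral_comp_div (fun y => d.b (x - y) * (L * Kr (L * y))) L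
    rw [abs_of_pos hL, smul_eq_mul] at e1
    have e2 : ∀ y, L * (y / L) = y := fun y => by field_simp
    simp_rw [e2] at e1
    have e3 : ∫ y, d.b (x - y / L) * (L * Kr y) = L * ∫ y, d.b (x - y / L) * Kr y := by
      rw [← integral_const_mul]; congr 1; ext y; ring
    rw [e3] at e1
    have e4 := mul_left_cancel₀ hL.ne' e1
    rw [e4, ← integral_sub_left_eq_self _ volume x]
    refine Eq.trans ?_ (integral_ofReal (𝕜 := ℂ))
    congr 1; ext y
    rw [IF_scale κ hL, hK]; push_cast; simp
  have h1 : ContDiff ℝ (⊤ : ℕ∞) (fun t => κ (t / L)) := hκ.comp (contDiff_id.div_const _)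
  have h2 : HasCompactSupport (fun t => κ (t / L)) := by
    have := hκs.comp_homeomorph (Homeomorph.mulRight₀ L⁻¹ (by positivity))
    exact this
  have h3 := d.smooth_tendsto h1 h2
  simp_rw [hrep] at h3
  have h4 := (tendsto_zero_iff_norm_tendsto_zero.1 h3).eventually_lt_const
    (show 0 < I0 * ε / 3 by positivity)
  have h5 : Tendsto (fun x => 2 * M / (L * (x - X))) atTop (𝓝 0) := by
    refine Tendsto.const_div_atTop (Tendsto.const_mul_atTop hL ?_) _
    exact tendsto_atTop_add_const_right _ _ tendsto_id
  filter_upwards [h4, h5.eventually_lt_const hη0, eventually_gt_atTop X] with x hx1 hx2 hx3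
  rw [Complex.norm_real, Real.norm_eq_abs] at hx1
  rw [Real.dist_eq, sub_zero]
  have ib : Integrable (fun y => d.b (x - y / L) * Kr y) := by
    have hm := d.measurable_b
    refine (iA.const_mul (|d.b x| + (C / L + 2 * M / (L * (x - X))))).mono' ?_ ?_
    · exact (Measurable.aestronglyMeasurable (by fun_prop)).mul i0.aestronglyMeasurable
    · refine Eventually.of_forall fun y => ?_
      rw [norm_mul, Real.norm_eq_abs, Real.norm_eq_abs, abs_of_nonneg (hK0 y), ← mul_assoc]
      refine mul_le_mul_of_nonneg_right ?_ (hK0 y)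
      have t1 := abs_sub (d.b x) (d.b x - d.b (x - y / L))
      rw [sub_sub_cancel] at t1
      have t2 := hb x hx3 y
      have t3 : |d.b x| ≤ |d.b x| * (|y| + 1) := le_mul_of_one_le_right (abs_nonneg _) (by linarith [abs_nonneg y])
      linarith
  have key : |d.b x * I0 - ∫ y, d.b (x - y / L) * Kr y| ≤ A * (C / L + 2 * M / (L * (x - X))) := by
    rw [hI0, ← integral_const_mul, ← integral_sub (i0.const_mul _) ib, hA, ← integral_mul_const,
      ← Real.norm_eq_abs]
    refine norm_integral_le_of_norm_le (iA.mul_const _) (Eventually.of_forall fun y => ?_)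
    rw [← sub_mul, norm_mul, Real.norm_eq_abs, Real.norm_eq_abs, abs_of_nonneg (hK0 y)]
    have := mul_le_mul_of_nonneg_right (hb x hx3 y) (hK0 y)
    linarith
  have k1 : C / L < η := by
    rw [hLdef, div_div_eq_mul_div, div_lt_iff₀ (by linarith)]
    nlinarith
  have k2 : A * (C / L + 2 * M / (L * (x - X))) ≤ A * (2 * η) :=
    mul_le_mul_of_nonneg_left (by linarith) hA0
  have k3 : A * (2 * η) ≤ 2 * (I0 * ε / 3) := by
    have : (A + 1) * η = I0 * ε / 3 := by rw [hη]; field_simp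
    nlinarith
  have k4 : |d.b x * I0| < I0 * ε := by
    have := abs_sub_abs_le_abs_sub (d.b x * I0) (∫ y, d.b (x - y / L) * Kr y)
    linarith
  rw [abs_mul, abs_of_pos hI, mul_comm] at k4
  exact lt_of_mul_lt_mul_left k4 hI.le

end Dat

/-- generalized integers supported on the first `n` primes -/
def Pn (n : ℕ) : Set (ℕ →₀ ℕ) := {α | α.support ⊆ Finset.range n}

lemma mem_Pn {n : ℕ} {α : ℕ →₀ ℕ} : α ∈ Pn n ↔ ∀ k, n ≤ k → α k = 0 := by
  unfold Pn
  rw [Set.mem_ofPred_eq, Finset.subset_iff]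
  constructor
  · intro h k hk
    by_contra h0
    have := h (Finsupp.mem_support_iff.2 h0)
    rw [Finset.mem_range] at this; omega
  · intro h k hk
    rw [Finset.mem_range]
    by_contra h0
    exact (Finsupp.mem_support_iff.1 hk) (h k (by omega))

noncomputable def PnEquiv (n : ℕ) : Pn n × ℕ ≃ Pn (n + 1) where
  toFun q := ⟨q.1.1 + Finsupp.single n q.2, by
    rw [mem_Pn]; intro k hk
    have := mem_Pn.1 q.1.2 k (by omega)
    rw [Finsupp.add_apply, this, Finsupp.single_apply, if_neg (by omega), add_zero]⟩
  invFun β := (⟨β.1.erase n, by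
    rw [mem_Pn]; intro k hk
    rw [Finsupp.erase_apply]
    split_ifs with h
    · rfl
    · exact mem_Pn.1 β.2 k (by omega)⟩, β.1 n)
  left_inv q := by
    have h := mem_Pn.1 q.1.2 n le_rfl
    ext k
    · simp only [Finsupp.erase_apply, Finsupp.add_apply, Finsupp.single_apply]
      split_ifs with h1 h2 <;> simp_all
    · simp [h]
  right_inv β := by
    ext k
    simp only [Finsupp.erase_apply, Finsupp.add_apply, Finsupp.single_apply]
    split_ifs with h1 h2 <;> simp_all

lemma prod_PnEquiv {R : Type*} [CommSemiring R] {f : ℕ → ℕ → R} (hf : ∀ k, f k 0 = 1) (n : ℕ) (q : Pn n × ℕ) :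
    ((PnEquiv n q).1).prod f = q.1.1.prod f * f n q.2 := by
  simp only [PnEquiv, Equiv.coe_fn_mk]
  rw [Finsupp.prod_add_index_of_disjoint, Finsupp.prod_single_index (hf n)]
  rw [Finset.disjoint_left]
  intro k hk hk2
  have h2 := Finsupp.support_single_subset hk2
  rw [Finset.mem_singleton] at h2
  subst h2
  exact (Finsupp.mem_support_iff.1 hk) (mem_Pn.1 q.1.2 _ le_rfl)

lemma hasSum_Pn {f : ℕ → ℕ → ℂ} (hf : ∀ k, f k 0 = 1) (hs : ∀ k, Summable fun e => ‖f k e‖) (n : ℕ) :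
    Summable (fun α : Pn n => ‖α.1.prod f‖) ∧
    HasSum (fun α : Pn n => α.1.prod f) (∏ k ∈ Finset.range n, ∑' e, f k e) := by
  induction n with
  | zero =>
    have hu : ∀ α : Pn 0, α = ⟨0, by rw [mem_Pn]; simp⟩ := by
      intro α; ext k; simpa using mem_Pn.1 α.2 k (Nat.zero_le _)
    have : Unique (Pn 0) := ⟨⟨_⟩, hu⟩
    have : Fintype (Pn 0) := Unique.fintype
    refine ⟨(hasSum_fintype _).summable, ?_⟩
    convert hasSum_fintype (fun α : Pn 0 => α.1.prod f) using 1
    rw [Fintype.sum_unique, hu default]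
    simp
  | succ n ih =>
    have h1 : Summable (fun q : Pn n × ℕ => ‖q.1.1.prod f * f n q.2‖) := ih.1.mul_norm (hs n)
    constructor
    · rw [← (PnEquiv n).summable_iff]
      refine h1.congr fun q => ?_
      rw [Function.comp_apply, prod_PnEquiv hf]
    · rw [← (PnEquiv n).hasSum_iff, Finset.prod_range_succ]
      have := ih.2.mul (hs n).of_norm.hasSum h1.of_norm
      refine this.congr_fun fun q => ?_
      rw [Function.comp_apply, prod_PnEquiv hf]

lemma euler_gen {f : ℕ → ℕ → ℂ} (hf : ∀ k, f k 0 = 1) {a : ℕ → ℝ} (ha : Summable a) {ρ : ℝ} (hρ : ρ < 1)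
    (ha0 : ∀ k, 0 ≤ a k) (haρ : ∀ k, a k ≤ ρ) (hfa : ∀ k e, ‖f k e‖ ≤ a k ^ e) {P : ℂ}
    (hP : Tendsto (fun n => ∏ k ∈ Finset.range n, ∑' e, f k e) atTop (𝓝 P)) :
    HasSum (fun α : ℕ →₀ ℕ => α.prod f) P := by
  have ha1 : ∀ k, a k < 1 := fun k => (haρ k).trans_lt hρ
  have hs : ∀ k, Summable fun e => ‖f k e‖ := fun k =>
    Summable.of_nonneg_of_le (fun e => norm_nonneg _) (hfa k) (summable_geometric_of_lt_one (ha0 k) (ha1 k))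
  -- norm version
  let f' : ℕ → ℕ → ℂ := fun k e => ((a k ^ e : ℝ) : ℂ)
  have hf' : ∀ k, f' k 0 = 1 := fun k => by simp [f']
  have hn' : ∀ k e, ‖f' k e‖ = a k ^ e := fun k e => by
    simp only [f']; rw [Complex.norm_real, Real.norm_eq_abs, abs_of_nonneg (pow_nonneg (ha0 k) e)]
  have hs' : ∀ k, Summable fun e => ‖f' k e‖ := fun k => by
    simp_rw [hn']; exact summable_geometric_of_lt_one (ha0 k) (ha1 k)
  have hprod' : ∀ α : ℕ →₀ ℕ, α.prod f' = ((α.prod fun k e => a k ^ e : ℝ) : ℂ) := fun α => by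
    simp [Finsupp.prod, f']
  have hnn : ∀ α : ℕ →₀ ℕ, 0 ≤ (α.prod fun k e => a k ^ e : ℝ) := fun α =>
    Finset.prod_nonneg fun k _ => pow_nonneg (ha0 k) _
  have hle : ∀ α : ℕ →₀ ℕ, ‖α.prod f‖ ≤ α.prod fun k e => a k ^ e := fun α => by
    unfold Finsupp.prod
    rw [norm_prod]
    exact Finset.prod_le_prod (fun _ _ => norm_nonneg _) fun k _ => hfa k _
  have hB : ∀ n, ∏ k ∈ Finset.range n, (1 - a k)⁻¹ ≤ Real.exp ((∑' k, a k) / (1 - ρ)) := by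
    intro n
    have h1 : ∀ k ∈ Finset.range n, (1 - a k)⁻¹ ≤ Real.exp (a k / (1 - ρ)) := by
      intro k _
      have p1 : 0 < 1 - a k := by linarith [ha1 k]
      have p2 : (1 - a k)⁻¹ = a k / (1 - a k) + 1 := by field_simp; ring
      rw [p2]
      refine le_trans ?_ (Real.add_one_le_exp _)
      have := ha0 k
      have := haρ k
      gcongr
    refine (Finset.prod_le_prod (fun k _ => inv_nonneg.2 (by linarith [ha1 k])) h1).trans ?_
    rw [← Real.exp_sum, ← Finset.sum_div]
    have h2 := ha.sum_le_tsum (Finset.range n) (fun k _ => ha0 k)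
    have h3 : 0 < 1 - ρ := by linarith
    gcongr
  have hsumm : Summable (fun α : ℕ →₀ ℕ => (α.prod fun k e => a k ^ e : ℝ)) := by
    refine summable_of_sum_le (c := Real.exp ((∑' k, a k) / (1 - ρ))) hnn fun u => ?_
    obtain ⟨n, hn⟩ : ∃ n, ∀ α ∈ u, α ∈ Pn n := by
      refine ⟨(u.sup Finsupp.support).sup (fun k => k + 1), fun α hα => ?_⟩
      rw [mem_Pn]; intro k hk
      by_contra h0
      have h1 : k ∈ u.sup Finsupp.support := Finset.mem_sup.2 ⟨α, hα, Finsupp.mem_support_iff.2 h0⟩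
      have h2 := Finset.le_sup (f := fun k => k + 1) h1
      omega
    have h1 := (hasSum_Pn hf' hs' n).2
    have h2 : ∀ k, ∑' e, f' k e = (((1 - a k)⁻¹ : ℝ) : ℂ) := by
      intro k
      simp only [f']
      rw [← Complex.ofReal_tsum, tsum_geometric_of_lt_one (ha0 k) (ha1 k)]
    simp_rw [h2, hprod', ← Complex.ofReal_prod] at h1
    have h3 := Complex.hasSum_ofReal.1 h1
    have h4 := sum_le_hasSum (u.subtype (· ∈ Pn n)) (fun α _ => hnn α.1) h3
    refine le_trans ?_ (h4.trans (hB n))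
    rw [Finset.sum_subtype_of_mem (fun α : ℕ →₀ ℕ => (α.prod fun k e => a k ^ e : ℝ)) hn]
  have hsf : Summable (fun α : ℕ →₀ ℕ => α.prod f) :=
    Summable.of_norm (Summable.of_nonneg_of_le (fun _ => norm_nonneg _) hle hsumm)
  have hlim : Tendsto (fun n => ∑' α : ℕ →₀ ℕ, (Pn n).indicator (fun α => α.prod f) α) atTop
      (𝓝 (∑' α : ℕ →₀ ℕ, α.prod f)) := by
    refine tendsto_tsum_of_dominated_convergence hsumm ?_ ?_
    · intro α
      refine tendsto_const_nhds.congr' ?_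
      filter_upwards [eventually_ge_atTop (α.support.sup (fun k => k + 1))] with n hn
      rw [indicator_of_mem]
      rw [mem_Pn]; intro k hk
      by_contra h0
      have h2 := Finset.le_sup (f := fun k => k + 1) (Finsupp.mem_support_iff.2 h0)
      omega
    · refine Eventually.of_forall fun n α => ?_
      refine (norm_indicator_le_norm_self _ _).trans (hle α)
  have h5 : ∀ n, ∑' α : ℕ →₀ ℕ, (Pn n).indicator (fun α => α.prod f) α =
      ∏ k ∈ Finset.range n, ∑' e, f k e := by
    intro n
    rw [← tsum_subtype]
    exact (hasSum_Pn hf hs n).2.tsum_eq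
  simp_rw [h5] at hlim
  rw [tendsto_nhds_unique hP hlim]
  exact hsf.hasSum

lemma muB_prod (α : ℕ →₀ ℕ) :
    muB α = α.prod fun _ e => if e = 0 then (1:ℝ) else if e = 1 then -1 else 0 := by
  unfold muB Finsupp.prod
  split_ifs with h
  · rw [Finset.prod_congr rfl (g := fun _ => (-1 : ℝ)), Finset.prod_const]
    intro k hk
    have h1 := Finsupp.mem_support_iff.1 hk
    have h2 : α k = 1 := by have := h k; omega
    simp [h2]
  · push Not at h
    obtain ⟨k, hk⟩ := h
    symm
    refine Finset.prod_eq_zero (i := k) (Finsupp.mem_support_iff.2 (by omega)) ?_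
    beta_reduce
    rw [if_neg (by omega), if_neg (by omega)]

lemma euler_both {z : ℕ → ℂ} (hz : Summable fun k => ‖z k‖) {ρ : ℝ} (hρ : ρ < 1) (hzρ : ∀ k, ‖z k‖ ≤ ρ)
    {H : ℂ} (hH : HasSum (fun k => -Complex.log (1 - z k)) H) :
    HasSum (fun α : ℕ →₀ ℕ => α.prod fun k e => z k ^ e) (Complex.exp H) ∧
    HasSum (fun α : ℕ →₀ ℕ => (muB α : ℂ) * α.prod fun k e => z k ^ e) (Complex.exp (-H)) := by
  have hz1 : ∀ k, ‖z k‖ < 1 := fun k => (hzρ k).trans_lt hρ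
  have hne : ∀ k, 1 - z k ≠ 0 := fun k h => by
    have : z k = 1 := (sub_eq_zero.1 h).symm
    have h2 := hz1 k
    rw [this] at h2; simp at h2
  constructor
  · refine euler_gen (f := fun k e => z k ^ e) (by simp) hz hρ (fun _ => norm_nonneg _) hzρ (fun k e => (norm_pow _ _).le) ?_
    have h1 := (Complex.continuous_exp.tendsto H).comp hH.tendsto_sum_nat
    refine h1.congr fun n => ?_
    rw [Function.comp_apply, Complex.exp_sum]
    refine Finset.prod_congr rfl fun k _ => ?_
    rw [tsum_geometric_of_norm_lt_one (hz1 k), Complex.exp_neg, Complex.exp_log (hne k)]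
  · let f : ℕ → ℕ → ℂ := fun k e => (if e = 0 then 1 else if e = 1 then -1 else 0) * z k ^ e
    have hmain : HasSum (fun α : ℕ →₀ ℕ => α.prod f) (Complex.exp (-H)) := by
      refine euler_gen (f := f) (by simp [f]) hz hρ (fun _ => norm_nonneg _) hzρ (fun k e => ?_) ?_
      · simp only [f]
        rw [norm_mul, norm_pow]
        refine mul_le_of_le_one_left (by positivity) ?_
        split_ifs <;> simp
      · have h1 := (Complex.continuous_exp.tendsto (-H)).comp hH.neg.tendsto_sum_nat
        refine h1.congr fun n => ?_
        rw [Function.comp_apply, Complex.exp_sum]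
        refine Finset.prod_congr rfl fun k _ => ?_
        rw [tsum_eq_sum (s := Finset.range 2)]
        · rw [neg_neg, Complex.exp_log (hne k)]
          simp [f, Finset.sum_range_succ]; ring
        · intro e he
          rw [Finset.mem_range] at he
          simp only [f]
          rw [if_neg (by omega), if_neg (by omega), zero_mul]
    refine hmain.congr_fun fun α => ?_
    rw [muB_prod]
    unfold Finsupp.prod
    push_cast
    rw [← Finset.prod_mul_distrib]
    refine Finset.prod_congr rfl fun k _ => ?_
    simp only [f]
    split_ifs <;> simp

noncomputable def ww (u : ℝ) : ℝ := (1 - Real.exp (-u)) / u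

lemma ww_nonneg {u : ℝ} (hu : 0 < u) : 0 ≤ ww u :=
  div_nonneg (by have := Real.exp_le_one_iff.2 (by linarith : -u ≤ 0); linarith) hu.le

lemma ww_le_one {u : ℝ} (hu : 0 < u) : ww u ≤ 1 := by
  unfold ww
  rw [div_le_one hu]
  have := Real.add_one_le_exp (-u)
  linarith

lemma measurable_ww : Measurable ww := by unfold ww; fun_prop

lemma ww_eq {u : ℝ} (hu : 0 < u) : (ww u : ℂ) = ∫ r in Ioc (0:ℝ) 1, Complex.exp (-(r * u)) := by
  rw [← intervalIntegral.integral_of_le zero_le_one]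
  have := integral_exp_mul_complex (c := -(u : ℂ)) (by simpa using hu.ne') (a := 0) (b := 1)
  have e : ∀ r : ℝ, Complex.exp (-(r * u)) = Complex.exp (-(u : ℂ) * r) := fun r => by congr 1; ring
  simp_rw [e, this]
  unfold ww
  have h0 : (u : ℂ) ≠ 0 := by exact_mod_cast hu.ne'
  push_cast
  simp
  field_simp
  ring

/-- `r ↦ 1/(r+s)` integral -/
noncomputable def Jw (s : ℂ) : ℂ := ∫ r in Ioc (0:ℝ) 1, ((r : ℂ) + s)⁻¹

lemma rs_ne {s : ℂ} (hs : 0 < s.re) {r : ℝ} (hr : 0 ≤ r) : (r : ℂ) + s ≠ 0 := by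
  intro h
  have := congrArg Complex.re h
  simp at this; linarith

lemma exp_Jw {s : ℂ} (hs : 0 < s.re) : Complex.exp (Jw s) = (1 + s) / s := by
  unfold Jw
  rw [← intervalIntegral.integral_of_le zero_le_one]
  have h1 : ∀ r ∈ uIcc (0:ℝ) 1, HasDerivAt (fun r : ℝ => Complex.log ((r : ℂ) + s)) ((r : ℂ) + s)⁻¹ r := by
    intro r hr
    rw [uIcc_of_le zero_le_one] at hr
    have h2 : HasDerivAt (fun r : ℝ => (r : ℂ) + s) 1 r := (Complex.ofRealCLM.hasDerivAt).add_const s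
    have := h2.clog_real (Or.inl (by simp; linarith [hr.1]))
    rwa [one_div] at this
  rw [intervalIntegral.integral_eq_sub_of_hasDerivAt h1]
  · have h0 := rs_ne hs (le_refl 0)
    have h3 := rs_ne hs (zero_le_one)
    rw [Complex.exp_sub, Complex.exp_log h3, Complex.exp_log h0]
    simp
  · apply ContinuousOn.intervalIntegrable
    rw [uIcc_of_le zero_le_one]
    exact ContinuousOn.inv₀ (by fun_prop) fun r hr => rs_ne hs hr.1

lemma int_exp {s : ℂ} (hs : 0 < s.re) {r : ℝ} (hr : 0 ≤ r) :
    ∫ u in Ioi (0:ℝ), Complex.exp (-(r * u)) * Complex.exp (-(s * u)) = ((r : ℂ) + s)⁻¹ := by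
  have := integral_exp_mul_complex_Ioi (a := -((r : ℂ) + s)) (by simp; linarith) 0
  have e : ∀ u : ℝ, Complex.exp (-(r * u)) * Complex.exp (-(s * u)) = Complex.exp (-((r : ℂ) + s) * u) := by
    intro u; rw [← Complex.exp_add]; congr 1; ring
  simp_rw [e, this]
  rw [Complex.ofReal_zero, mul_zero, Complex.exp_zero, neg_div_neg_eq, one_div]

lemma norm_exp_su (s : ℂ) (u : ℝ) : ‖Complex.exp (-(s * u))‖ = Real.exp (-(s.re * u)) := by
  rw [Complex.norm_exp]; simp

lemma integrableOn_exp_re {σ : ℝ} (hσ : 0 < σ) : IntegrableOn (fun u : ℝ => Real.exp (-(σ * u))) (Ioi 0) :=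
  (integrableOn_exp_mul_Ioi (a := -σ) (by linarith) 0).congr_fun (fun v _ => by ring_nf) measurableSet_Ioi

lemma ae_prod_pos : ∀ᵐ z ∂((volume.restrict (Ioi (0:ℝ))).prod (volume.restrict (Ioc (0:ℝ) 1))),
    0 < z.1 ∧ 0 < z.2 ∧ z.2 ≤ 1 := by
  rw [Measure.prod_restrict, ae_restrict_iff' (measurableSet_Ioi.prod measurableSet_Ioc)]
  exact Eventually.of_forall fun z hz => ⟨hz.1, hz.2.1, hz.2.2⟩

lemma lap_ww {s : ℂ} (hs : 0 < s.re) :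
    ∫ u in Ioi (0:ℝ), (ww u : ℂ) * Complex.exp (-(s * u)) = Jw s := by
  unfold Jw
  have e1 : ∫ u in Ioi (0:ℝ), (ww u : ℂ) * Complex.exp (-(s * u)) =
      ∫ u in Ioi (0:ℝ), ∫ r in Ioc (0:ℝ) 1, Complex.exp (-(r * u)) * Complex.exp (-(s * u)) := by
    refine setIntegral_congr_fun measurableSet_Ioi fun u hu => ?_
    rw [ww_eq hu, ← integral_mul_const]
  rw [e1, integral_integral_swap]
  · refine setIntegral_congr_fun measurableSet_Ioc fun r hr => ?_
    exact int_exp hs hr.1.le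
  · have h1 : Integrable (fun z : ℝ × ℝ => Real.exp (-(s.re * z.1)) * (1:ℝ))
        ((volume.restrict (Ioi (0:ℝ))).prod (volume.restrict (Ioc (0:ℝ) 1))) :=
      (integrableOn_exp_re hs).integrable.mul_prod (integrable_const 1)
    refine h1.mono' (Continuous.aestronglyMeasurable (by unfold Function.uncurry; fun_prop)) ?_
    filter_upwards [ae_prod_pos] with z hz
    simp only [Function.uncurry]
    rw [norm_mul, norm_exp_su, norm_exp_su, mul_comm]
    gcongr
    rw [Real.exp_le_one_iff, Complex.ofReal_re]
    have := mul_pos hz.1 hz.2.1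
    linarith

noncomputable def g0 (u : ℝ) : ℂ := ∫ r in Ioc (0:ℝ) 1, (r : ℂ) * Complex.exp (-(r * u))

lemma int_prod_g0 : Integrable (Function.uncurry fun (u r : ℝ) => (r : ℂ) * Complex.exp (-(r * u)))
    ((volume.restrict (Ioi (0:ℝ))).prod (volume.restrict (Ioc (0:ℝ) 1))) := by
  rw [integrable_prod_iff']
  · constructor
    · rw [ae_restrict_iff' measurableSet_Ioc]
      refine Eventually.of_forall fun r hr => ?_
      simp only [Function.uncurry]
      refine Integrable.const_mul ?_ _
      have := integrableOn_exp_mul_complex_Ioi (a := -(r : ℂ)) (by simpa using hr.1) 0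
      refine this.congr_fun (fun u _ => ?_) measurableSet_Ioi
      simp only; congr 1; ring
    · have h1 : IntegrableOn (fun _ : ℝ => (1:ℝ)) (Ioc 0 1) := by simp
      refine h1.congr_fun (fun r hr => ?_) measurableSet_Ioc
      simp only [Function.uncurry]
      simp_rw [norm_mul, norm_exp_su, Complex.ofReal_re]
      rw [integral_const_mul, Complex.norm_real, Real.norm_eq_abs, abs_of_pos hr.1]
      have := integral_exp_mul_Ioi (a := -r) (by linarith [hr.1]) 0
      simp_rw [← neg_mul, this]
      have := hr.1.ne'
      simp; field_simp
  · exact Continuous.aestronglyMeasurable (by unfold Function.uncurry; fun_prop)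

lemma measurable_g0 : Measurable g0 := by
  unfold g0
  apply StronglyMeasurable.measurable
  apply StronglyMeasurable.integral_prod_right (f := fun (u r : ℝ) => (r : ℂ) * Complex.exp (-(r * u)))
  apply Continuous.stronglyMeasurable
  unfold Function.uncurry; fun_prop

lemma integrableOn_g0 : IntegrableOn g0 (Ioi 0) := int_prod_g0.integral_prod_left

lemma lap_g0 {s : ℂ} (hs : 0 < s.re) :
    ∫ u in Ioi (0:ℝ), g0 u * Complex.exp (-(s * u)) = 1 - s * Jw s := by
  unfold g0
  simp_rw [← integral_mul_const]
  rw [integral_integral_swap]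
  · have : ∀ r ∈ Ioc (0:ℝ) 1, ∫ u in Ioi (0:ℝ), (r : ℂ) * Complex.exp (-(r * u)) * Complex.exp (-(s * u)) =
        1 - s * ((r : ℂ) + s)⁻¹ := by
      intro r hr
      simp_rw [mul_assoc]
      rw [integral_const_mul, int_exp hs hr.1.le]
      have := rs_ne hs hr.1.le
      field_simp
      ring
    rw [setIntegral_congr_fun measurableSet_Ioc this, integral_sub (by simp), integral_const_mul]
    · simp [Jw]
    · refine Integrable.const_mul ?_ _
      refine IntegrableOn.mono_set (ContinuousOn.integrableOn_Icc ?_) Ioc_subset_Icc_self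
      exact ContinuousOn.inv₀ (by fun_prop) fun r hr => rs_ne hs hr.1
  · have h3 := int_prod_g0.mul_bdd (c := 1) (g := fun z : ℝ × ℝ => Complex.exp (-(s * z.1))) ?_ ?_
    · exact h3
    · exact Continuous.aestronglyMeasurable (by fun_prop)
    · filter_upwards [ae_prod_pos] with z hz
      rw [norm_exp_su, Real.exp_le_one_iff]
      have := mul_pos hs hz.1
      linarith

/-- a generalized number system -/
structure Sys (p : ℕ → ℝ) : Prop where
  hmono : Monotone p
  hp1 : 1 < p 0
  hptop : Tendsto p atTop atTop

namespace Sys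
variable {p : ℕ → ℝ} (S : Sys p)

lemma one_lt (S : Sys p) (k : ℕ) : 1 < p k := S.hp1.trans_le (S.hmono (Nat.zero_le k))
lemma pos (S : Sys p) (k : ℕ) : 0 < p k := zero_lt_one.trans (S.one_lt k)
lemma log0_pos (S : Sys p) : 0 < Real.log (p 0) := Real.log_pos S.hp1
lemma log0_le (S : Sys p) (k : ℕ) : Real.log (p 0) ≤ Real.log (p k) :=
  Real.log_le_log (S.pos 0) (S.hmono (Nat.zero_le k))
lemma log_pos (S : Sys p) (k : ℕ) : 0 < Real.log (p k) := Real.log_pos (S.one_lt k)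

/-- `(j+1) log p_k` -/
noncomputable def qv (p : ℕ → ℝ) (q : ℕ × ℕ) : ℝ := (q.1 + 1) * Real.log (p q.2)

lemma qv_pos (S : Sys p) (q : ℕ × ℕ) : 0 < qv p q := mul_pos (by positivity) (S.log_pos _)

lemma finite_log (S : Sys p) (u : ℝ) : {k | Real.log (p k) ≤ u}.Finite := by
  have h1 : Tendsto (fun k => Real.log (p k)) atTop atTop := Real.tendsto_log_atTop.comp S.hptop
  have h2 := h1.eventually_gt_atTop u
  rw [← Nat.cofinite_eq_atTop, eventually_cofinite] at h2
  simpa using h2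

lemma finQ (S : Sys p) (u : ℝ) : {q | qv p q ≤ u}.Finite := by
  have h1 : {j : ℕ | (j : ℝ) + 1 ≤ u / Real.log (p 0)}.Finite := by
    refine (Set.finite_Iic ⌈u / Real.log (p 0)⌉₊).subset fun j hj => ?_
    rw [mem_Iic]
    rw [mem_ofPred_eq] at hj
    have : (j : ℝ) ≤ (⌈u / Real.log (p 0)⌉₊ : ℝ) := by
      have := Nat.le_ceil (u / Real.log (p 0)); linarith
    exact_mod_cast this
  refine (h1.prod (S.finite_log u)).subset fun q hq => ?_
  rw [mem_ofPred_eq] at hq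
  unfold qv at hq
  have a1 := S.log0_le q.2
  have a2 := S.log_pos q.2
  have a3 := S.log0_pos
  have a4 : (0:ℝ) ≤ q.1 := Nat.cast_nonneg _
  refine ⟨?_, ?_⟩
  · rw [mem_ofPred_eq, le_div_iff₀ a3]
    nlinarith
  · rw [mem_ofPred_eq]; nlinarith

noncomputable def TQ (S : Sys p) (u : ℝ) : Finset (ℕ × ℕ) := (S.finQ u).toFinset

lemma mem_TQ (S : Sys p) {u : ℝ} {q : ℕ × ℕ} : q ∈ S.TQ u ↔ qv p q ≤ u := by simp [TQ]

lemma Pi_eq (S : Sys p) (u : ℝ) : PiCount p (Real.exp u) = ∑ q ∈ S.TQ u, (1:ℝ) / (q.1 + 1) := by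
  have hsupp : ∀ q ∉ S.TQ u, (if qv p q ≤ u then (1:ℝ) / (q.1 + 1) else 0) = 0 := by
    intro q hq; rw [mem_TQ] at hq; rw [if_neg hq]
  have h1 : ∑ q ∈ S.TQ u, (1:ℝ) / (q.1 + 1) = ∑' q : ℕ × ℕ, if qv p q ≤ u then (1:ℝ) / (q.1 + 1) else 0 := by
    rw [tsum_eq_sum hsupp]
    refine Finset.sum_congr rfl fun q hq => ?_
    rw [mem_TQ] at hq; rw [if_pos hq]
  have h2 : Summable (fun q : ℕ × ℕ => if qv p q ≤ u then (1:ℝ) / (q.1 + 1) else 0) :=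
    summable_of_ne_finset_zero hsupp
  rw [h1, h2.tsum_prod]
  unfold PiCount
  congr 1; ext j
  have hj : (0:ℝ) < j + 1 := by positivity
  have h3 : ∀ k, p k ≤ Real.exp u ^ ((1 : ℝ) / (j + 1)) ↔ qv p (j, k) ≤ u := by
    intro k
    rw [← Real.exp_mul, ← Real.log_le_iff_le_exp (S.pos k), mul_one_div, le_div_iff₀ hj]
    unfold qv; rw [mul_comm]
  simp_rw [h3]
  have hfin : {k | qv p (j, k) ≤ u}.Finite := by
    refine (S.finite_log u).subset fun k hk => ?_
    rw [mem_ofPred_eq] at hk ⊢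
    unfold qv at hk
    have a2 := S.log_pos k
    have a4 : (0:ℝ) ≤ j := Nat.cast_nonneg _
    simp only at hk
    nlinarith
  rw [tsum_eq_sum (s := hfin.toFinset)]
  · rw [Finset.sum_congr rfl (g := fun _ => (1:ℝ) / (j + 1))]
    · rw [Finset.sum_const, nsmul_eq_mul, mul_one_div]
      congr 2
      exact Nat.card_eq_card_finite_toFinset hfin
    · intro k hk
      rw [Set.Finite.mem_toFinset, mem_ofPred_eq] at hk
      rw [if_pos hk]
  · intro k hk
    rw [Set.Finite.mem_toFinset, mem_ofPred_eq] at hk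
    rw [if_neg hk]

lemma Pi_mono (S : Sys p) : Monotone fun u => PiCount p (Real.exp u) := by
  intro u v h
  beta_reduce
  rw [S.Pi_eq, S.Pi_eq]
  refine Finset.sum_le_sum_of_subset_of_nonneg ?_ fun q _ _ => by positivity
  intro q hq; rw [mem_TQ] at *; linarith

lemma Pi_nonneg (S : Sys p) (u : ℝ) : 0 ≤ PiCount p (Real.exp u) := by
  rw [S.Pi_eq]; exact Finset.sum_nonneg fun q _ => by positivity

noncomputable def Psi (p : ℕ → ℝ) (u : ℝ) : ℝ := PiCount p (Real.exp u) * Real.exp (-u)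

lemma Psi_nonneg (S : Sys p) (u : ℝ) : 0 ≤ Psi p u := mul_nonneg (S.Pi_nonneg u) (Real.exp_pos _).le

lemma measurable_Psi (S : Sys p) : Measurable (Psi p) := by
  unfold Psi
  exact S.Pi_mono.measurable.mul (by fun_prop)

noncomputable def eR (p : ℕ → ℝ) (u : ℝ) : ℝ := Psi p u - ww u

lemma measurable_eR (S : Sys p) : Measurable (eR p) := S.measurable_Psi.sub measurable_ww

lemma integrableOn_eR (S : Sys p) (hL1 : ∫⁻ x in Set.Ici (2:ℝ),
      ENNReal.ofReal (|PiCount p x - x / Real.log x| / x ^ 2) < ⊤) : IntegrableOn (eR p) (Ioi 0) := by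
  have hl2 : 0 < Real.log 2 := Real.log_pos (by norm_num)
  have hsplit : Ioi (0:ℝ) = Ioo 0 (Real.log 2) ∪ Ici (Real.log 2) := (Ioo_union_Ici_eq_Ioi hl2).symm
  rw [hsplit]
  refine IntegrableOn.union ?_ ?_
  · refine Measure.integrableOn_of_bounded (M := PiCount p (Real.exp (Real.log 2)) + 1) (by simp)
      S.measurable_eR.aestronglyMeasurable ?_
    rw [ae_restrict_iff' measurableSet_Ioo]
    refine Eventually.of_forall fun u hu => ?_
    unfold eR
    refine (norm_sub_le _ _).trans (add_le_add ?_ ?_)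
    · rw [Real.norm_eq_abs, abs_of_nonneg (S.Psi_nonneg u)]
      unfold Psi
      have h1 : Real.exp (-u) ≤ 1 := Real.exp_le_one_iff.2 (by linarith [hu.1])
      exact (mul_le_of_le_one_right (S.Pi_nonneg u) h1).trans (S.Pi_mono hu.2.le)
    · rw [Real.norm_eq_abs, abs_of_nonneg (ww_nonneg hu.1)]
      exact ww_le_one hu.1
  · have himg : Real.exp '' Ici (Real.log 2) = Ici 2 := by
      ext x
      constructor
      · rintro ⟨u, hu, rfl⟩
        rw [mem_Ici] at *
        rwa [Real.log_le_iff_le_exp (by norm_num)] at hu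
      · intro hx
        rw [mem_Ici] at hx
        refine ⟨Real.log x, ?_, Real.exp_log (by linarith)⟩
        exact Real.log_le_log (by norm_num) hx
    rw [← himg, lintegral_image_eq_lintegral_abs_deriv_mul measurableSet_Ici
      (fun x _ => (Real.hasDerivAt_exp x).hasDerivWithinAt) Real.exp_injective.injOn] at hL1
    have h1 : IntegrableOn (fun u => Psi p u - 1 / u) (Ici (Real.log 2)) := by
      refine ⟨(S.measurable_Psi.sub (by fun_prop)).aestronglyMeasurable, ?_⟩
      unfold HasFiniteIntegral
      refine lt_of_eq_of_lt ?_ hL1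
      refine setLIntegral_congr_fun measurableSet_Ici fun u hu => ?_
      have hu0 : 0 < u := hl2.trans_le hu
      beta_reduce
      rw [← ofReal_norm, ← ENNReal.ofReal_mul (abs_nonneg _), Real.log_exp]
      congr 1
      rw [abs_of_pos (Real.exp_pos u), Real.norm_eq_abs]
      have : Psi p u - 1 / u = (PiCount p (Real.exp u) - Real.exp u / u) * Real.exp (-u) := by
        unfold Psi
        rw [sub_mul, div_mul_eq_mul_div, ← Real.exp_add]; simp
      rw [this, abs_mul, abs_of_pos (Real.exp_pos _), Real.exp_neg]
      have := Real.exp_pos u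
      field_simp
    have h2 : IntegrableOn (fun u : ℝ => Real.exp (-u) / u) (Ici (Real.log 2)) := by
      have h3 : IntegrableOn (fun u : ℝ => Real.exp (-u) * (Real.log 2)⁻¹) (Ici (Real.log 2)) := by
        refine Integrable.mul_const ?_ _
        have := (integrableOn_exp_re one_pos).mono_set (s := Ici (Real.log 2)) (fun u hu => hl2.trans_le hu)
        simp only [one_mul] at this
        exact this
      refine h3.mono' (Measurable.aestronglyMeasurable (by fun_prop)) ?_
      rw [ae_restrict_iff' measurableSet_Ici]
      refine Eventually.of_forall fun u hu => ?_
      have hu0 : 0 < u := hl2.trans_le hu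
      rw [mem_Ici] at hu
      rw [Real.norm_eq_abs, abs_of_nonneg (by positivity), div_eq_mul_inv]
      gcongr
    refine (h1.add h2).congr (Eventually.of_forall fun u => ?_)
    simp only [Pi.add_apply]
    unfold eR ww
    ring

lemma integrableOn_Psi (S : Sys p) (hL1 : ∫⁻ x in Set.Ici (2:ℝ),
      ENNReal.ofReal (|PiCount p x - x / Real.log x| / x ^ 2) < ⊤) {σ : ℝ} (hσ : 0 < σ) :
    IntegrableOn (fun u => Psi p u * Real.exp (-(σ * u))) (Ioi 0) := by
  have h1 := S.integrableOn_eR hL1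
  have h2 : IntegrableOn (fun u => |eR p u| + Real.exp (-(σ * u))) (Ioi 0) :=
    h1.norm.add (integrableOn_exp_re hσ)
  refine h2.mono' (S.measurable_Psi.mul (by fun_prop)).aestronglyMeasurable ?_
  rw [ae_restrict_iff' measurableSet_Ioi]
  refine Eventually.of_forall fun u hu => ?_
  have hE := Real.exp_pos (-(σ * u))
  have hE1 : Real.exp (-(σ * u)) ≤ 1 := Real.exp_le_one_iff.2 (by have := mul_pos hσ hu; linarith)
  rw [Real.norm_eq_abs, abs_of_nonneg (mul_nonneg (S.Psi_nonneg u) hE.le)]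
  have h3 : Psi p u = eR p u + ww u := by unfold eR; ring
  have h4 := ww_le_one hu
  have h5 := le_abs_self (eR p u)
  have h6 := abs_nonneg (eR p u)
  rw [h3, add_mul]
  nlinarith [mul_le_mul_of_nonneg_right h5 hE.le, mul_le_of_le_one_right h6 hE1]

end Sys

namespace Sys
variable {p : ℕ → ℝ}

lemma hasSum_Q (S : Sys p) (hL1 : ∫⁻ x in Set.Ici (2:ℝ),
      ENNReal.ofReal (|PiCount p x - x / Real.log x| / x ^ 2) < ⊤) {s : ℂ} (hs : 0 < s.re) :
    Summable (fun q : ℕ × ℕ => ‖(1 / ((q.1:ℂ) + 1)) * Complex.exp (-((1 + s) * qv p q))‖) ∧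
    HasSum (fun q : ℕ × ℕ => (1 / ((q.1:ℂ) + 1)) * Complex.exp (-((1 + s) * qv p q)))
      ((1 + s) * ∫ u in Ioi (0:ℝ), (Psi p u : ℂ) * Complex.exp (-(s * u))) := by
  have hs1 : 0 < (1 + s).re := by simp; linarith
  have hne : 1 + s ≠ 0 := fun h => by rw [h] at hs1; simp at hs1
  let f : ℕ × ℕ → ℝ → ℂ := fun q => (Ioi (qv p q)).indicator
    (fun u => (((1:ℝ) / (q.1 + 1) : ℝ) : ℂ) * Complex.exp (-(1 + s) * u))
  have hre : (-(1 + s)).re < 0 := by rw [Complex.neg_re]; linarith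
  have hfi : ∀ q, Integrable (f q) := fun q =>
    IntegrableOn.integrable_indicator (Integrable.const_mul (integrableOn_exp_mul_complex_Ioi hre _) _)
      measurableSet_Ioi
  have hint : ∀ q, ∫ u, f q u = (1 + s)⁻¹ * ((1 / ((q.1:ℂ) + 1)) * Complex.exp (-((1 + s) * qv p q))) := by
    intro q
    simp only [f]
    rw [integral_indicator measurableSet_Ioi, integral_const_mul, integral_exp_mul_complex_Ioi hre,
      neg_div_neg_eq]
    push_cast
    rw [neg_mul]
    field_simp
  have hnorm : ∀ q u, ‖f q u‖ = (Ioi (qv p q)).indicator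
      (fun u => ((1:ℝ) / (q.1 + 1)) * Real.exp (-((1 + s.re) * u))) u := by
    intro q u
    simp only [f]
    rw [norm_indicator_eq_indicator_norm]
    congr 1; ext u
    rw [norm_mul, Complex.norm_real, Real.norm_eq_abs, abs_of_pos (by positivity), neg_mul, norm_exp_su]
    simp
  have hPsi := (S.integrableOn_Psi hL1 hs).integrable_indicator measurableSet_Ioi
  have hsum : Summable fun q => ∫ u, ‖f q u‖ := by
    refine summable_of_sum_le (c := ∫ u, (Ioi (0:ℝ)).indicator (fun u => Psi p u * Real.exp (-(s.re * u))) u)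
      (fun q => integral_nonneg fun u => norm_nonneg _) fun T => ?_
    rw [← integral_finsetSum _ (fun q _ => (hfi q).norm)]
    refine integral_mono (integrable_finsetSum _ fun q _ => (hfi q).norm) hPsi fun u => ?_
    beta_reduce
    rcases le_or_gt u 0 with hu | hu
    · rw [indicator_of_notMem (by simpa using hu)]
      refine (Finset.sum_eq_zero fun q _ => ?_).le
      rw [hnorm, indicator_of_notMem]
      have := S.qv_pos q
      simp; linarith
    · rw [indicator_of_mem (by simpa using hu)]
      unfold Psi
      rw [S.Pi_eq]
      have e1 : ∑ q ∈ S.TQ u, (1:ℝ) / (q.1 + 1) * Real.exp (-u) * Real.exp (-(s.re * u)) =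
         (∑ q ∈ S.TQ u, (1:ℝ) / (q.1 + 1)) * Real.exp (-u) * Real.exp (-(s.re * u)) := by
        rw [Finset.sum_mul, Finset.sum_mul]
      rw [← e1]
      have e2 : ∑ q ∈ T, ‖f q u‖ = ∑ q ∈ T.filter (fun q => q ∈ S.TQ u), ‖f q u‖ := by
        rw [Finset.sum_filter_of_ne]
        intro q _ hq
        rw [mem_TQ]
        by_contra h
        apply hq
        rw [hnorm, indicator_of_notMem]
        simp; linarith
      rw [e2]
      refine le_trans (Finset.sum_le_sum (g := fun q => (1:ℝ) / (q.1 + 1) * Real.exp (-u) * Real.exp (-(s.re * u)))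
        fun q hq => ?_) (Finset.sum_le_sum_of_subset_of_nonneg (fun q hq => (Finset.mem_filter.1 hq).2)
        fun q _ _ => by positivity)
      rw [hnorm]
      refine (indicator_le_self' (fun _ _ => by positivity) _).trans (le_of_eq ?_)
      rw [mul_assoc, ← Real.exp_add]; congr 2; ring
  have h1 := hasSum_integral_of_summable_integral_norm hfi hsum
  have hb : (∫ u, ∑' q, f q u) = ∫ u in Ioi (0:ℝ), (Psi p u : ℂ) * Complex.exp (-(s * u)) := by
    rw [← integral_indicator measurableSet_Ioi]
    refine integral_congr_ae ?_
    have hae : ∀ᵐ u : ℝ, ∀ q, u ≠ qv p q := by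
      rw [ae_all_iff]; intro i
      exact Measure.ae_ne volume _
    filter_upwards [hae] with u hu
    rcases le_or_gt u 0 with hu0 | hu0
    · rw [indicator_of_notMem (by simpa using hu0)]
      have : ∀ q, f q u = 0 := by
        intro q
        simp only [f]
        rw [indicator_of_notMem]
        have := S.qv_pos q
        simp; linarith
      simp [this]
    · rw [indicator_of_mem (by simpa using hu0), tsum_eq_sum (s := S.TQ u)]
      · unfold Psi
        rw [S.Pi_eq]
        push_cast
        rw [Finset.sum_mul, Finset.sum_mul]
        refine Finset.sum_congr rfl fun q hq => ?_
        rw [mem_TQ] at hq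
        have : qv p q < u := lt_of_le_of_ne hq (hu q).symm
        simp only [f]
        rw [indicator_of_mem (by simpa using this), mul_assoc, ← Complex.exp_add]
        push_cast
        congr 2; ring
      · intro q hq
        rw [mem_TQ, not_le] at hq
        simp only [f]
        rw [indicator_of_notMem (by simpa using hq.le)]
  rw [hb] at h1
  simp_rw [hint] at h1
  have h2 := h1.mul_left (1 + s)
  simp_rw [mul_inv_cancel_left₀ hne] at h2
  refine ⟨?_, h2⟩
  have h3 : ∀ q : ℕ × ℕ, ‖(1 / ((q.1:ℂ) + 1)) * Complex.exp (-((1 + s) * qv p q))‖ ≤ ‖1 + s‖ * ∫ u, ‖f q u‖ := by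
    intro q
    have := norm_integral_le_integral_norm (f q) (μ := volume)
    rw [hint, norm_mul, norm_inv, inv_mul_le_iff₀ (norm_pos_iff.2 hne)] at this
    exact this
  exact Summable.of_nonneg_of_le (fun _ => norm_nonneg _) h3 (hsum.mul_left _)

noncomputable def zk (p : ℕ → ℝ) (s : ℂ) (k : ℕ) : ℂ := Complex.exp (-((1 + s) * Real.log (p k)))

lemma euler (S : Sys p) (hL1 : ∫⁻ x in Set.Ici (2:ℝ),
      ENNReal.ofReal (|PiCount p x - x / Real.log x| / x ^ 2) < ⊤) {s : ℂ} (hs : 0 < s.re) :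
    HasSum (fun α : ℕ →₀ ℕ => α.prod fun k e => zk p s k ^ e)
      (Complex.exp ((1 + s) * ∫ u in Ioi (0:ℝ), (Psi p u : ℂ) * Complex.exp (-(s * u)))) ∧
    HasSum (fun α : ℕ →₀ ℕ => (muB α : ℂ) * α.prod fun k e => zk p s k ^ e)
      (Complex.exp (-((1 + s) * ∫ u in Ioi (0:ℝ), (Psi p u : ℂ) * Complex.exp (-(s * u))))) := by
  obtain ⟨h1, h2⟩ := S.hasSum_Q hL1 hs
  have hnz : ∀ k, ‖zk p s k‖ ≤ Real.exp (-Real.log (p 0)) := by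
    intro k
    unfold zk
    rw [norm_exp_su, Real.exp_le_exp]
    have := S.log0_le k
    have := S.log_pos k
    simp only [Complex.add_re, Complex.one_re]
    nlinarith
  have hρ : Real.exp (-Real.log (p 0)) < 1 := by
    rw [Real.exp_lt_one_iff]; linarith [S.log0_pos]
  have hz1 : ∀ k, ‖zk p s k‖ < 1 := fun k => (hnz k).trans_lt hρ
  have hterm : ∀ j k : ℕ, (1 / ((j:ℂ) + 1)) * Complex.exp (-((1 + s) * qv p (j, k))) =
      zk p s k ^ (j + 1) / ((j + 1 : ℕ) : ℂ) := by
    intro j k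
    unfold zk qv
    rw [← Complex.exp_nat_mul]
    push_cast
    rw [div_mul_eq_mul_div, one_mul]
    congr 2; ring
  refine euler_both ?_ hρ hnz ?_
  · have := h1.comp_injective (i := fun k : ℕ => (0, k)) (fun a b h => by simpa using h)
    refine this.congr fun k => ?_
    rw [Function.comp_apply]
    simp only [hterm]
    simp
  · have h3 := ((Equiv.prodComm ℕ ℕ).hasSum_iff).2 h2
    refine h3.prod_fiberwise fun k => ?_
    have h4 := Complex.hasSum_taylorSeries_neg_log (hz1 k)
    rw [← hasSum_nat_add_iff' 1] at h4
    simp only [Finset.range_one, Finset.sum_singleton, pow_zero, Nat.cast_zero, div_zero, sub_zero] at h4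
    refine h4.congr_fun fun j => ?_
    simp only [Function.comp_apply, Equiv.prodComm_apply, Prod.swap_prod_mk]
    rw [hterm]

/-- the exponential identity for zeta -/
lemma exp_H (S : Sys p) (hL1 : ∫⁻ x in Set.Ici (2:ℝ),
      ENNReal.ofReal (|PiCount p x - x / Real.log x| / x ^ 2) < ⊤) {s : ℂ} (hs : 0 < s.re) :
    Complex.exp ((1 + s) * ∫ u in Ioi (0:ℝ), (Psi p u : ℂ) * Complex.exp (-(s * u))) =
      Fd ((Ioi 0).indicator fun u => (eR p u : ℂ)) ((Ioi 0).indicator fun u => -g0 u) s / s := by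
  have hs0 : s ≠ 0 := fun h => by rw [h] at hs; simp at hs
  have hs1 : 1 + s ≠ 0 := fun h => by
    have := congrArg Complex.re h; simp at this; linarith
  have ha : ∀ a : ℝ → ℂ, lap ((Ioi 0).indicator a) s = ∫ u in Ioi (0:ℝ), a u * Complex.exp (-(s * u)) := by
    intro a
    unfold lap
    rw [← integral_indicator measurableSet_Ioi]
    congr 1; ext u
    simp only [indicator]; split_ifs <;> simp
  have hg : lap ((Ioi 0).indicator fun u => -g0 u) s = -(1 - s * Jw s) := by
    rw [ha, ← lap_g0 hs, ← integral_neg]; congr 1; ext u; ring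
  have hE : ∫ u in Ioi (0:ℝ), (Psi p u : ℂ) * Complex.exp (-(s * u)) =
      lap ((Ioi 0).indicator fun u => (eR p u : ℂ)) s + Jw s := by
    rw [ha, ← lap_ww hs, ← integral_add]
    · congr 1; ext u; unfold eR; push_cast; ring
    · have h1 : IntegrableOn (fun u => (eR p u : ℂ)) (Ioi 0) := (S.integrableOn_eR hL1).ofReal
      refine Integrable.mul_bdd (c := 1) h1 (Continuous.aestronglyMeasurable (by fun_prop)) ?_
      rw [ae_restrict_iff' measurableSet_Ioi]
      refine Eventually.of_forall fun u hu => ?_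
      rw [norm_exp_su, Real.exp_le_one_iff]
      have := mul_pos hs hu
      linarith
    · refine (integrableOn_exp_re hs).mono' ?_ ?_
      · exact ((Complex.measurable_ofReal.comp measurable_ww).aestronglyMeasurable).mul
          (Continuous.aestronglyMeasurable (by fun_prop))
      rw [ae_restrict_iff' measurableSet_Ioi]
      refine Eventually.of_forall fun u hu => ?_
      rw [norm_mul, norm_exp_su, Complex.norm_real, Real.norm_eq_abs, abs_of_nonneg (ww_nonneg hu)]
      exact mul_le_of_le_one_left (Real.exp_pos _).le (ww_le_one hu)
  rw [hE]
  unfold Fd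
  rw [hg]
  set l := lap ((Ioi 0).indicator fun u => (eR p u : ℂ)) s
  have e1 : (1 + s) * (l + Jw s) = Jw s + (1 + ((1 + s) * l + -(1 - s * Jw s))) := by ring
  rw [e1, Complex.exp_add, exp_Jw hs, Complex.exp_add 1]
  field_simp

lemma nval_pos (S : Sys p) (α : ℕ →₀ ℕ) : 0 < nval p α := by
  unfold nval Finsupp.prod
  exact Finset.prod_pos fun k _ => pow_pos (S.pos k) _

lemma exp_log_nval (S : Sys p) (s : ℂ) (α : ℕ →₀ ℕ) :
    Complex.exp (-((1 + s) * Real.log (nval p α))) = α.prod fun k e => zk p s k ^ e := by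
  unfold nval Finsupp.prod zk
  rw [Real.log_prod (fun k _ => (pow_pos (S.pos k) _).ne')]
  push_cast
  rw [Finset.mul_sum, ← Finset.sum_neg_distrib, Complex.exp_sum]
  refine Finset.prod_congr rfl fun k _ => ?_
  rw [← Complex.exp_nat_mul, Real.log_pow]
  push_cast
  congr 1; ring

noncomputable def dat (S : Sys p) (hL1 : ∫⁻ x in Set.Ici (2:ℝ),
      ENNReal.ofReal (|PiCount p x - x / Real.log x| / x ^ 2) < ⊤) : Dat where
  ι := ℕ →₀ ℕ
  cnt := inferInstance
  ℓ α := Real.log (nval p α)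
  ℓ0 α := by
    refine Real.log_nonneg ?_
    unfold nval Finsupp.prod
    exact Finset.prod_induction _ (fun x : ℝ => 1 ≤ x) (fun a b => one_le_mul_of_one_le_of_one_le) le_rfl
      fun k _ => one_le_pow₀ (S.one_lt k).le
  μ := muB
  μ1 α := by
    unfold muB; split_ifs
    · rw [abs_pow]; simp
    · simp
  e := (Ioi 0).indicator fun u => (eR p u : ℂ)
  g := (Ioi 0).indicator fun u => -g0 u
  me := (Complex.measurable_ofReal.comp S.measurable_eR).indicator measurableSet_Ioi
  mg := measurable_g0.neg.indicator measurableSet_Ioi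
  ie := IntegrableOn.integrable_indicator ((S.integrableOn_eR hL1).ofReal) measurableSet_Ioi
  ig := IntegrableOn.integrable_indicator integrableOn_g0.neg measurableSet_Ioi
  e0 u hu := indicator_of_notMem (by simpa using hu.le) _
  g0 u hu := indicator_of_notMem (by simpa using hu.le) _
  hZ σ t hσ := by
    have hs : 0 < (sv σ t).re := by rw [sv_re]; exact hσ
    simp_rw [S.exp_log_nval]
    rw [← S.exp_H hL1 hs]
    exact (S.euler hL1 hs).1
  hM σ t hσ := by
    have hs : 0 < (sv σ t).re := by rw [sv_re]; exact hσ
    simp_rw [S.exp_log_nval]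
    rw [← inv_div, ← S.exp_H hL1 hs, ← Complex.exp_neg]
    exact (S.euler hL1 hs).2

lemma mB_eq (S : Sys p) (hL1 : ∫⁻ x in Set.Ici (2:ℝ),
      ENNReal.ofReal (|PiCount p x - x / Real.log x| / x ^ 2) < ⊤) {x : ℝ} (hx : 0 < x) :
    mB p x = (S.dat hL1).b (Real.log x) := by
  have hmem : ∀ α : (S.dat hL1).ι, α ∈ (S.dat hL1).T (Real.log x) ↔ nval p α ≤ x := fun α =>
    (S.dat hL1).mem_T.trans (Real.log_le_log_iff (S.nval_pos α) hx)
  let Tf : Finset (ℕ →₀ ℕ) := (S.dat hL1).T (Real.log x)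
  have hTf : ∀ α : ℕ →₀ ℕ, α ∈ Tf ↔ nval p α ≤ x := hmem
  have hb : (S.dat hL1).b (Real.log x) = ∑ α ∈ Tf, muB α * Real.exp (-Real.log (nval p α)) := rfl
  rw [hb]
  unfold mB
  have h1 := tsum_subtype {α : ℕ →₀ ℕ | nval p α ≤ x} (fun α => muB α / nval p α)
  refine h1.trans ?_
  rw [tsum_eq_sum (s := Tf)]
  · refine Finset.sum_congr rfl fun α hα => ?_
    rw [indicator_of_mem (show α ∈ {α : ℕ →₀ ℕ | nval p α ≤ x} from (hTf α).1 hα), div_eq_mul_inv,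
      Real.exp_neg, Real.exp_log (S.nval_pos α)]
  · intro α hα
    rw [indicator_of_notMem]
    exact fun h => hα ((hTf α).2 h)

end Sys

/-- Kahane–Saïas: the L¹ hypothesis implies `m(x) = o(1)`. -/
theorem stmt_6 (p : ℕ → ℝ) (hmono : Monotone p) (hp1 : 1 < p 0)
    (hptop : Tendsto p atTop atTop)
    (hL1 : ∫⁻ x in Set.Ici (2:ℝ),
      ENNReal.ofReal (|PiCount p x - x / Real.log x| / x ^ 2) < ⊤) :
    Tendsto (mB p) atTop (𝓝 0) := by
  have S : Sys p := ⟨hmono, hp1, hptop⟩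
  have h := ((S.dat hL1).tendsto_b).comp Real.tendsto_log_atTop
  refine h.congr' ?_
  filter_upwards [eventually_gt_atTop 0] with x hx
  exact (S.mB_eq hL1 hx).symm
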